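/- arXiv:math-ph/0501050 — 16 statements merged into one kernel-verified Lean document; each statement's English description precedes it below -/
import Mathlib

section
/- Let f₀ : Ω → ℝ be a nonvanishing twice continuously differentiable solution of (−Δ + ν) f₀ = 0 on Ω, where ν : Ω → ℝ. Then for every real-valued twice continuously differentiable function φ on Ω the factorization identity (Δ − ν)φ = ∂_z̄ w + (∂_z f₀ / f₀)·conj(w) holds pointwise on Ω, where w = ∂_z φ − (∂_z f₀ / f₀)·φ. (This is the two-dimensional factorization (Δ − ν) = (∂_z̄ + (∂_z f₀/f₀)C)(∂_z − (∂_z f₀/f₀)), C denoting complex conjugation.) -/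
open Complex ComplexConjugate

/-- Partial derivative in the `x` direction of a complex-valued function on `ℂ ≃ ℝ²`. -/
noncomputable def pdxC (f : ℂ → ℂ) (z : ℂ) : ℂ := fderiv ℝ f z 1

/-- Partial derivative in the `y` direction of a complex-valued function on `ℂ ≃ ℝ²`. -/
noncomputable def pdyC (f : ℂ → ℂ) (z : ℂ) : ℂ := fderiv ℝ f z Complex.I

/-- `∂_z f = ∂f/∂x − i ∂f/∂y` (without the factor 1/2). -/
noncomputable def dzC (f : ℂ → ℂ) (z : ℂ) : ℂ := pdxC f z - Complex.I * pdyC f z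

/-- `∂_z̄ f = ∂f/∂x + i ∂f/∂y` (without the factor 1/2). -/
noncomputable def dzbarC (f : ℂ → ℂ) (z : ℂ) : ℂ := pdxC f z + Complex.I * pdyC f z

/-- Partial derivative in the `x` direction of a real-valued function on `ℂ ≃ ℝ²`. -/
noncomputable def pdxR (f : ℂ → ℝ) (z : ℂ) : ℝ := fderiv ℝ f z 1

/-- Partial derivative in the `y` direction of a real-valued function on `ℂ ≃ ℝ²`. -/
noncomputable def pdyR (f : ℂ → ℝ) (z : ℂ) : ℝ := fderiv ℝ f z Complex.I

/-- `∂_z f` for a real-valued `f`. -/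
noncomputable def dzR (f : ℂ → ℝ) (z : ℂ) : ℂ := (pdxR f z : ℂ) - Complex.I * (pdyR f z : ℂ)

/-- `∂_z̄ f` for a real-valued `f`. -/
noncomputable def dzbarR (f : ℂ → ℝ) (z : ℂ) : ℂ := (pdxR f z : ℂ) + Complex.I * (pdyR f z : ℂ)

/-- The Laplacian `Δ f = ∂²f/∂x² + ∂²f/∂y²` of a real-valued function on `ℂ ≃ ℝ²`. -/
noncomputable def lapR (f : ℂ → ℝ) (z : ℂ) : ℝ := pdxR (pdxR f) z + pdyR (pdyR f) z

/-- `|∇f|² = (∂_x f)² + (∂_y f)²` for a real-valued function on `ℂ ≃ ℝ²`. -/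
noncomputable def gradNormSq (f : ℂ → ℝ) (z : ℂ) : ℝ := (pdxR f z) ^ 2 + (pdyR f z) ^ 2

theorem aux_pd (f : ℂ → ℝ) (z : ℂ) (hf : ContDiffAt ℝ 2 f z) :
    DifferentiableAt ℝ f z ∧ DifferentiableAt ℝ (pdxR f) z ∧ DifferentiableAt ℝ (pdyR f) z ∧
      fderiv ℝ (pdxR f) z Complex.I = fderiv ℝ (pdyR f) z 1 := by
  have h1 : DifferentiableAt ℝ (fderiv ℝ f) z :=
    (hf.fderiv_right (m := 1) (by norm_num)).differentiableAt (by norm_num)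
  have hs : IsSymmSndFDerivAt ℝ f z := hf.isSymmSndFDerivAt (by simp)
  have key : ∀ v : ℂ, HasFDerivAt (fun y => fderiv ℝ f y v)
      ((ContinuousLinearMap.apply ℝ ℝ v).comp (fderiv ℝ (fderiv ℝ f) z)) z := fun v =>
    (ContinuousLinearMap.apply ℝ ℝ v).hasFDerivAt.comp z h1.hasFDerivAt
  have hx : HasFDerivAt (pdxR f) _ z := key 1
  have hy : HasFDerivAt (pdyR f) _ z := key Complex.I
  refine ⟨hf.differentiableAt (by norm_num), hx.differentiableAt, hy.differentiableAt, ?_⟩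
  rw [hx.fderiv, hy.fderiv]
  exact hs.eq _ _

theorem aux_fd (g p q f : ℂ → ℝ) (z : ℂ) (hg : DifferentiableAt ℝ g z)
    (hp : DifferentiableAt ℝ p z) (hq : DifferentiableAt ℝ q z) (hf : DifferentiableAt ℝ f z)
    (h0 : f z ≠ 0) :
    ∃ L : ℂ →L[ℝ] ℝ, HasFDerivAt (fun y => g y - p y / f y * q y) L z ∧
      ∀ v, L v = fderiv ℝ g z v - ((fderiv ℝ p z v * f z - p z * fderiv ℝ f z v) / f z ^ 2 * q z
        + p z / f z * fderiv ℝ q z v) := by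
  have hi := (hasDerivAt_inv h0).comp_hasFDerivAt z hf.hasFDerivAt
  have := hg.hasFDerivAt.sub ((hp.hasFDerivAt.mul hi).mul hq.hasFDerivAt)
  refine ⟨_, this.congr_of_eventuallyEq (.of_forall fun y => ?_), fun v => ?_⟩
  · simp [div_eq_mul_inv]
  · simp
    field_simp
    ring

/-- factorization of the Schrödinger operator
`(Δ − ν)φ = (∂_z̄ + (∂_z f₀/f₀)C)(∂_z − (∂_z f₀/f₀))φ`. -/
theorem schrodinger_factorization
    (Ω : Set ℂ) (hΩ : IsOpen Ω) (ν f₀ φ : ℂ → ℝ)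
    (hf₀C2 : ContDiffOn ℝ 2 f₀ Ω)
    (hf₀ne : ∀ z ∈ Ω, f₀ z ≠ 0)
    (hf₀sol : ∀ z ∈ Ω, lapR f₀ z = ν z * f₀ z)
    (hφC2 : ContDiffOn ℝ 2 φ Ω)
    (w : ℂ → ℂ)
    (hw : ∀ z ∈ Ω, w z = dzR φ z - dzR f₀ z / (f₀ z : ℂ) * (φ z : ℂ)) :
    ∀ z ∈ Ω,
      ((lapR φ z : ℂ) - (ν z : ℂ) * (φ z : ℂ))
        = dzbarC w z + dzR f₀ z / (f₀ z : ℂ) * conj (w z) := by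
  intro z hz
  have hN := hΩ.mem_nhds hz
  obtain ⟨f1, f2, f3, f4⟩ := aux_pd f₀ z (hf₀C2.contDiffAt hN)
  obtain ⟨p1, p2, p3, p4⟩ := aux_pd φ z (hφC2.contDiffAt hN)
  have h0 := hf₀ne z hz
  obtain ⟨L, hL, hLv⟩ := aux_fd (pdxR φ) (pdxR f₀) φ f₀ z p2 f2 p1 f1 h0
  obtain ⟨M, hM, hMv⟩ := aux_fd (pdyR φ) (pdyR f₀) φ f₀ z p3 f3 p1 f1 h0
  have hW := (Complex.ofRealCLM.hasFDerivAt.comp z hL).sub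
    ((Complex.ofRealCLM.hasFDerivAt.comp z hM).const_mul Complex.I)
  have hW' := hW.congr_of_eventuallyEq (f₁ := w) (by
    filter_upwards [hN] with y hy
    rw [hw y hy]
    simp [dzR]
    ring)
  have hν : ν z = lapR f₀ z / f₀ z := by rw [hf₀sol z hz]; field_simp
  have h0' : (f₀ z : ℂ) ≠ 0 := by exact_mod_cast h0
  rw [hw z hz, hν]
  simp only [dzbarC, pdxC, pdyC, hW'.fderiv]
  simp [hLv, hMv, p4, f4, dzR, lapR]
  simp only [pdxR, pdyR] at *
  field_simp
  apply Complex.ext <;> simp [pow_two] <;> ring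
end

section
/- Let b : Ω → ℂ be continuously differentiable such that ∂_z b is real-valued on Ω, and let W = u + iv (u, v real-valued) be a twice continuously differentiable solution of ∂_z̄ W = b·conj(W) on Ω. Then u satisfies ∂_z̄ ∂_z u − (b·conj(b) + ∂_z b)·u = 0 on Ω, and v satisfies ∂_z̄ ∂_z v − (b·conj(b) − ∂_z b)·v = 0 on Ω. -/
open Complex ComplexConjugate

lemma bauer_diff (Ω : Set ℂ) (hΩ : IsOpen Ω) (W : ℂ → ℂ)
    (hWC2 : ContDiffOn ℝ 2 W Ω) (z : ℂ) (hz : z ∈ Ω) :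
    DifferentiableAt ℝ (fderiv ℝ W) z := by
  have h : ContDiffAt ℝ 2 W z := hWC2.contDiffAt (hΩ.mem_nhds hz)
  exact (h.fderiv_right (m := 1) (by norm_num)).differentiableAt (by norm_num)

lemma bauer_symm (Ω : Set ℂ) (hΩ : IsOpen Ω) (W : ℂ → ℂ)
    (hWC2 : ContDiffOn ℝ 2 W Ω) (z : ℂ) (hz : z ∈ Ω) :
    fderiv ℝ (fderiv ℝ W) z 1 I = fderiv ℝ (fderiv ℝ W) z I 1 := by
  have h : ContDiffAt ℝ 2 W z := hWC2.contDiffAt (hΩ.mem_nhds hz)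
  exact (h.isSymmSndFDerivAt (by simp)) 1 I

lemma bauer_dd (Ω : Set ℂ) (hΩ : IsOpen Ω) (W : ℂ → ℂ)
    (hWC2 : ContDiffOn ℝ 2 W Ω) (p : ℂ →L[ℝ] ℝ) (z : ℂ) (hz : z ∈ Ω) :
    dzbarC (fun ζ => dzR (fun w => p (W w)) ζ) z =
      (p (fderiv ℝ (fderiv ℝ W) z 1 1 + fderiv ℝ (fderiv ℝ W) z I I) : ℝ) := by
  have hd := bauer_diff Ω hΩ W hWC2 z hz
  have hs := bauer_symm Ω hΩ W hWC2 z hz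
  have he : (fun ζ => dzR (fun w => p (W w)) ζ) =ᶠ[nhds z]
      (fun ζ => Complex.ofRealCLM (p (fderiv ℝ W ζ 1))
        - I * Complex.ofRealCLM (p (fderiv ℝ W ζ I))) := by
    filter_upwards [hΩ.mem_nhds hz] with ζ hζ
    have hW : DifferentiableAt ℝ W ζ :=
      (hWC2.contDiffAt (hΩ.mem_nhds hζ)).differentiableAt (by norm_num)
    have := (p.hasFDerivAt.comp ζ hW.hasFDerivAt).fderiv
    have h2 : fderiv ℝ (fun w => p (W w)) ζ = p.comp (fderiv ℝ W ζ) := this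
    simp [dzR, pdxR, pdyR, h2]
  have hev : ∀ v : ℂ, HasFDerivAt (fun ζ => Complex.ofRealCLM (p (fderiv ℝ W ζ v)))
      (Complex.ofRealCLM.comp (p.comp ((fderiv ℝ (fderiv ℝ W) z).flip v))) z := by
    intro v
    have h0 := ((ContinuousLinearMap.apply ℝ ℂ v).hasFDerivAt).comp z hd.hasFDerivAt
    exact Complex.ofRealCLM.hasFDerivAt.comp z (p.hasFDerivAt.comp z h0)
  have hD := ((hev 1).sub ((hev I).const_mul I)).congr_of_eventuallyEq he
  simp only [dzbarC, pdxC, pdyC, hD.fderiv]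
  simp [hs]
  linear_combination (-(p (fderiv ℝ (fderiv ℝ W) z I I)) : ℂ) * Complex.I_sq

lemma bauer_lapl (Ω : Set ℂ) (hΩ : IsOpen Ω) (b W : ℂ → ℂ)
    (hbC1 : ContDiffOn ℝ 1 b Ω)
    (hWC2 : ContDiffOn ℝ 2 W Ω)
    (hVekua : ∀ z ∈ Ω, dzbarC W z = b z * conj (W z)) (z : ℂ) (hz : z ∈ Ω) :
    fderiv ℝ (fderiv ℝ W) z 1 1 + fderiv ℝ (fderiv ℝ W) z I I =
      dzC b z * conj (W z) + b z * conj (b z) * W z := by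
  have hd := bauer_diff Ω hΩ W hWC2 z hz
  have hs := bauer_symm Ω hΩ W hWC2 z hz
  have hW : DifferentiableAt ℝ W z :=
    (hWC2.contDiffAt (hΩ.mem_nhds hz)).differentiableAt (by norm_num)
  have hb : DifferentiableAt ℝ b z :=
    (hbC1.contDiffAt (hΩ.mem_nhds hz)).differentiableAt (by norm_num)
  have he : (fun ζ => fderiv ℝ W ζ 1 + I * fderiv ℝ W ζ I) =ᶠ[nhds z]
      (fun ζ => b ζ * conj (W ζ)) := by
    filter_upwards [hΩ.mem_nhds hz] with ζ hζ using hVekua ζ hζ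
  have hev : ∀ v : ℂ, HasFDerivAt (fun ζ => fderiv ℝ W ζ v)
      ((fderiv ℝ (fderiv ℝ W) z).flip v) z := fun v =>
    ((ContinuousLinearMap.apply ℝ ℂ v).hasFDerivAt).comp z hd.hasFDerivAt
  have hc : HasFDerivAt (fun ζ => conj (W ζ))
      ((Complex.conjCLE : ℂ →L[ℝ] ℂ).comp (fderiv ℝ W z)) z :=
    (Complex.conjCLE : ℂ →L[ℝ] ℂ).hasFDerivAt.comp z hW.hasFDerivAt
  have hL := (hev 1).add ((hev I).const_mul I)
  have hR := (hb.hasFDerivAt.mul hc).congr_of_eventuallyEq he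
  have hU := hL.unique hR
  have h1 := DFunLike.congr_fun hU 1
  have hI := DFunLike.congr_fun hU I
  have hv := congrArg conj (hVekua z hz)
  simp [dzbarC, pdxC, pdyC] at hv
  simp at h1 hI
  simp only [dzC, pdxC, pdyC]
  linear_combination h1 - I * hI - I * hs + b z * hv +
    (fderiv ℝ (fderiv ℝ W) z I I) * Complex.I_sq

/-- Proposition of Bauer: if `∂_z b` is real valued and `W = u + iv` solves
`∂_z̄ W = b conj(W)`, then `∂_z̄∂_z u − (b conj(b) + ∂_z b) u = 0` and
`∂_z̄∂_z v − (b conj(b) − ∂_z b) v = 0`. -/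
theorem bauer_proposition
    (Ω : Set ℂ) (hΩ : IsOpen Ω) (b W : ℂ → ℂ)
    (hbC1 : ContDiffOn ℝ 1 b Ω)
    (hbz_real : ∀ z ∈ Ω, (dzC b z).im = 0)
    (hWC2 : ContDiffOn ℝ 2 W Ω)
    (hVekua : ∀ z ∈ Ω, dzbarC W z = b z * conj (W z)) :
    (∀ z ∈ Ω,
      dzbarC (fun ζ => dzR (fun w => (W w).re) ζ) z
        - (b z * conj (b z) + dzC b z) * ((W z).re : ℂ) = 0) ∧
    (∀ z ∈ Ω,
      dzbarC (fun ζ => dzR (fun w => (W w).im) ζ) z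
        - (b z * conj (b z) - dzC b z) * ((W z).im : ℂ) = 0) := by
  have lapl := fun z hz => bauer_lapl Ω hΩ b W hbC1 hWC2 hVekua z hz
  constructor
  · intro z hz
    have h1 := bauer_dd Ω hΩ W hWC2 Complex.reCLM z hz
    have h2 := lapl z hz
    have h3 := hbz_real z hz
    simp only [Complex.reCLM_apply] at h1
    rw [h1, h2]
    apply Complex.ext <;> simp [h3] <;> ring_nf <;> simp
  · intro z hz
    have h1 := bauer_dd Ω hΩ W hWC2 Complex.imCLM z hz
    have h2 := lapl z hz
    have h3 := hbz_real z hz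
    simp only [Complex.imCLM_apply] at h1
    rw [h1, h2]
    apply Complex.ext <;> simp [h3] <;> ring_nf <;> simp
end

section
/- Let f₀ : Ω → ℝ be a nonvanishing twice continuously differentiable solution of Δ f₀ = ν f₀ on Ω (ν : Ω → ℝ), let w : Ω → ℂ be a continuously differentiable solution of the Vekua equation ∂_z̄ w + (∂_z f₀ / f₀)·conj(w) = 0 on Ω, and let φ : Ω → ℝ be twice continuously differentiable with ∂_z φ = w / f₀ on Ω. Then the function f = f₀ · φ satisfies Δ f = ν f on Ω. -/
open Complex ComplexConjugate

lemma aux_diff {Ω : Set ℂ} (hΩ : IsOpen Ω) {g : ℂ → ℝ} (hg : ContDiffOn ℝ 2 g Ω) {z : ℂ}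
    (hz : z ∈ Ω) (v : ℂ) :
    DifferentiableAt ℝ g z ∧ DifferentiableAt ℝ (fun y => fderiv ℝ g y v) z := by
  have h := hg.contDiffAt (hΩ.mem_nhds hz)
  refine ⟨h.differentiableAt (by norm_num), ?_⟩
  have h1 : ContDiffAt ℝ 1 (fderiv ℝ g) z := h.fderiv_right (by norm_num)
  exact (h1.differentiableAt (by norm_num)).clm_apply (differentiableAt_const v)

lemma aux_mul {a b : ℂ → ℝ} {z : ℂ} (ha : DifferentiableAt ℝ a z) (hb : DifferentiableAt ℝ b z)
    (v : ℂ) : fderiv ℝ (fun y => a y * b y) z v = a z * fderiv ℝ b z v + b z * fderiv ℝ a z v := by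
  rw [fderiv_fun_mul ha hb]; simp

lemma aux_mul2 {Ω : Set ℂ} (hΩ : IsOpen Ω) {a b : ℂ → ℝ} (ha : ContDiffOn ℝ 2 a Ω)
    (hb : ContDiffOn ℝ 2 b Ω) {z : ℂ} (hz : z ∈ Ω) (v : ℂ) :
    fderiv ℝ (fun y => fderiv ℝ (fun x => a x * b x) y v) z v =
      a z * fderiv ℝ (fun y => fderiv ℝ b y v) z v + 2 * (fderiv ℝ a z v * fderiv ℝ b z v)
       + b z * fderiv ℝ (fun y => fderiv ℝ a y v) z v := by
  have e : (fun y => fderiv ℝ (fun x => a x * b x) y v) =ᶠ[nhds z]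
      fun y => a y * fderiv ℝ b y v + b y * fderiv ℝ a y v := by
    filter_upwards [hΩ.mem_nhds hz] with y hy
    exact aux_mul (aux_diff hΩ ha hy v).1 (aux_diff hΩ hb hy v).1 v
  obtain ⟨a1, a2⟩ := aux_diff hΩ ha hz v
  obtain ⟨b1, b2⟩ := aux_diff hΩ hb hz v
  rw [e.fderiv_eq, fderiv_fun_add (a1.fun_mul b2) (b1.fun_mul a2), add_apply, aux_mul a1 b2, aux_mul b1 a2]
  ring

/-- if `w` solves the Vekua equation `∂_z̄ w + (∂_z f₀/f₀) conj(w) = 0` and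
`φ` is a real antiderivative with `∂_z φ = w/f₀`, then `f = f₀ φ` solves `Δf = ν f`
(the operator `S = f₀ A f₀⁻¹` maps solutions of the Vekua equation to solutions of the
Schrödinger equation). -/
theorem S_maps_Vekua_to_Schrodinger
    (Ω : Set ℂ) (hΩ : IsOpen Ω) (ν f₀ : ℂ → ℝ) (w : ℂ → ℂ) (φ : ℂ → ℝ)
    (hf₀C2 : ContDiffOn ℝ 2 f₀ Ω)
    (hf₀ne : ∀ z ∈ Ω, f₀ z ≠ 0)
    (hf₀sol : ∀ z ∈ Ω, lapR f₀ z = ν z * f₀ z)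
    (hwC1 : ContDiffOn ℝ 1 w Ω)
    (hVekua : ∀ z ∈ Ω, dzbarC w z + dzR f₀ z / (f₀ z : ℂ) * conj (w z) = 0)
    (hφC2 : ContDiffOn ℝ 2 φ Ω)
    (hφ : ∀ z ∈ Ω, dzR φ z = w z / (f₀ z : ℂ))
    (f : ℂ → ℝ) (hf : ∀ z, f z = f₀ z * φ z) :
    ∀ z ∈ Ω, lapR f z = ν z * f z := by
  intro z hz
  obtain rfl : f = fun y => f₀ y * φ y := funext hf
  have hw : DifferentiableAt ℝ w z :=
    (hwC1.contDiffAt (hΩ.mem_nhds hz)).differentiableAt (by norm_num)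
  have hweq : ∀ y ∈ Ω, w y = (f₀ y : ℂ) * dzR φ y := by
    intro y hy
    have : (f₀ y : ℂ) ≠ 0 := by exact_mod_cast hf₀ne y hy
    rw [hφ y hy]; field_simp
  have hre : ∀ y ∈ Ω, (w y).re = f₀ y * fderiv ℝ φ y 1 := by
    intro y hy; rw [hweq y hy]; simp [dzR, pdxR, pdyR]
  have him : ∀ y ∈ Ω, (w y).im = - (f₀ y * fderiv ℝ φ y I) := by
    intro y hy; rw [hweq y hy]; simp [dzR, pdxR, pdyR]
  have d1 : (fderiv ℝ w z 1).re = fderiv ℝ (fun y => f₀ y * fderiv ℝ φ y 1) z 1 := by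
    have e : (fun y => (w y).re) =ᶠ[nhds z] fun y => f₀ y * fderiv ℝ φ y 1 := by
      filter_upwards [hΩ.mem_nhds hz] with y hy using hre y hy
    rw [← e.fderiv_eq]
    have := (reCLM.hasFDerivAt.comp z hw.hasFDerivAt).fderiv
    exact (congrArg (fun L => L 1) this).symm
  have d2 : (fderiv ℝ w z I).im = - fderiv ℝ (fun y => f₀ y * fderiv ℝ φ y I) z I := by
    have e : (fun y => (w y).im) =ᶠ[nhds z] fun y => - (f₀ y * fderiv ℝ φ y I) := by
      filter_upwards [hΩ.mem_nhds hz] with y hy using him y hy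
    have := (imCLM.hasFDerivAt.comp z hw.hasFDerivAt).fderiv
    have h2 : (fderiv ℝ w z I).im = fderiv ℝ (fun y => (w y).im) z I :=
      (congrArg (fun L => L I) this).symm
    rw [h2, e.fderiv_eq, fderiv_fun_neg]; rfl
  have n0 := hf₀ne z hz
  have n1 : (f₀ z : ℂ) ≠ 0 := by exact_mod_cast n0
  have hV := hVekua z hz
  have hV2 : dzbarC w z + dzR f₀ z * conj (dzR φ z) = 0 := by
    rw [← hV, hweq z hz, map_mul, conj_ofReal]; field_simp
  have hV3 := congrArg Complex.re hV2
  simp only [dzbarC, dzR, pdxC, pdyC, pdxR, pdyR] at hV3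
  simp at hV3
  rw [d1, d2, aux_mul (aux_diff hΩ hf₀C2 hz 1).1 (aux_diff hΩ hφC2 hz 1).2,
    aux_mul (aux_diff hΩ hf₀C2 hz I).1 (aux_diff hΩ hφC2 hz I).2] at hV3
  have hs := hf₀sol z hz
  have m1 := aux_mul2 hΩ hf₀C2 hφC2 hz 1
  have m2 := aux_mul2 hΩ hf₀C2 hφC2 hz I
  change fderiv ℝ (fun y => fderiv ℝ f₀ y 1) z 1 + fderiv ℝ (fun y => fderiv ℝ f₀ y I) z I = _ at hs
  change fderiv ℝ (fun y => fderiv ℝ (fun x => f₀ x * φ x) y 1) z 1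
    + fderiv ℝ (fun y => fderiv ℝ (fun x => f₀ x * φ x) y I) z I = ν z * (f₀ z * φ z)
  rw [m1, m2]
  linear_combination hV3 + φ z * hs
end

section
/- Let f₀ : Ω → ℝ be nonvanishing and continuously differentiable, and let W : Ω → ℂ be a twice continuously differentiable solution of the main Vekua equation ∂_z̄ W = (∂_z̄ f₀ / f₀)·conj(W) on Ω. Then the function w = ∂_z W − (∂_z f₀ / f₀)·conj(W) (the (F,G)-derivative of W for the generating pair F = f₀, G = i/f₀) is a solution of the Vekua equation ∂_z̄ w + (∂_z f₀ / f₀)·conj(w) = 0 on Ω. -/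
open Complex ComplexConjugate

lemma hasFDerivAt_mul_of_zero {q g : ℂ → ℂ} {g' : ℂ →L[ℝ] ℂ} {z : ℂ}
    (hq : ContinuousAt q z) (hg : HasFDerivAt g g' z) (h0 : g z = 0) :
    HasFDerivAt (fun y => q y * g y) (q z • g') z := by
  have h1 : HasFDerivAt (fun y => q z * g y) (q z • g') z := hg.const_mul (q z)
  have h2 : HasFDerivAt (fun y => (q y - q z) * g y) (0 : ℂ →L[ℝ] ℂ) z := by
    refine HasFDerivAt.of_isLittleO ?_
    have hO : (fun y => g y) =O[nhds z] (fun y => y - z) := by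
      simpa [h0] using hg.isBigO_sub
    have ho : (fun y => q y - q z) =o[nhds z] (fun _ => (1 : ℂ)) := by
      rw [Asymptotics.isLittleO_one_iff]
      exact tendsto_sub_nhds_zero_iff.mpr hq
    simpa [h0] using ho.mul_isBigO hO
  have h3 := h1.add h2
  rw [add_zero] at h3
  refine h3.congr_of_eventuallyEq (Filter.Eventually.of_forall fun y => ?_)
  simp only [Pi.add_apply]
  ring

lemma hasFDerivAt_conj {g : ℂ → ℂ} {g' : ℂ →L[ℝ] ℂ} {z : ℂ} (hg : HasFDerivAt g g' z) :
    HasFDerivAt (fun y => conj (g y)) ((conjCLE : ℂ →L[ℝ] ℂ).comp g') z :=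
  ((conjCLE : ℂ →L[ℝ] ℂ).hasFDerivAt (x := g z)).comp z hg

lemma hasFDerivAt_ofReal {g : ℂ → ℝ} {g' : ℂ →L[ℝ] ℝ} {z : ℂ} (hg : HasFDerivAt g g' z) :
    HasFDerivAt (fun y => (g y : ℂ)) (ofRealCLM.comp g') z :=
  (ofRealCLM.hasFDerivAt (x := g z)).comp z hg

lemma fderiv_real_eq (f : ℂ → ℝ) (y : ℂ) :
    fderiv ℝ f y = pdxR f y • reCLM + pdyR f y • imCLM := by
  ext v
  have hv : v = v.re • (1 : ℂ) + v.im • I := by simp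
  conv_lhs => rw [hv]
  rw [map_add, map_smul, map_smul]
  simp [pdxR, pdyR, mul_comm]

lemma wirt_symm {W : ℂ → ℂ} {z : ℂ} (hW : ContDiffAt ℝ 2 W z) :
    ∃ A' B' : ℂ →L[ℝ] ℂ, HasFDerivAt (dzC W) A' z ∧ HasFDerivAt (dzbarC W) B' z ∧
      A' 1 + I * A' I = B' 1 - I * B' I := by
  have hd : DifferentiableAt ℝ (fderiv ℝ W) z :=
    (hW.fderiv_right (m := 1) (by norm_num)).differentiableAt (by norm_num)
  have hsym : fderiv ℝ (fderiv ℝ W) z 1 I = fderiv ℝ (fderiv ℝ W) z I 1 := by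
    refine second_derivative_symmetric_of_eventually (f := W) (f' := fderiv ℝ W) ?_
      hd.hasFDerivAt 1 I
    filter_upwards [hW.eventually (by simp)] with y hy
    exact (hy.differentiableAt (by norm_num)).hasFDerivAt
  have hx : HasFDerivAt (pdxC W) ((fderiv ℝ (fderiv ℝ W) z).flip 1) z := by
    have := hd.hasFDerivAt.clm_apply (hasFDerivAt_const (1 : ℂ) z)
    simp at this
    exact this
  have hy : HasFDerivAt (pdyC W) ((fderiv ℝ (fderiv ℝ W) z).flip I) z := by
    have := hd.hasFDerivAt.clm_apply (hasFDerivAt_const (I : ℂ) z)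
    simp at this
    exact this
  refine ⟨_, _, hx.sub (hy.const_mul I), hx.add (hy.const_mul I), ?_⟩
  simp only [_root_.sub_apply, _root_.add_apply,
    _root_.smul_apply, ContinuousLinearMap.flip_apply, smul_eq_mul, hsym]
  ring

/-- The quotient has a derivative with real Wirtinger part. -/
lemma q_deriv {f : ℂ → ℝ} {Q : ℂ → ℂ} {z : ℂ} (hf : ∀ᶠ y in nhds z, DifferentiableAt ℝ f y)
    (hne : ∀ᶠ y in nhds z, f y ≠ 0) (hQ : DifferentiableAt ℝ Q z)
    (hQe : ∀ᶠ y in nhds z, dzR f y / (f y : ℂ) = Q y) :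
    (fderiv ℝ Q z I).re = (fderiv ℝ Q z 1).im * (-1) := by
  have hfz := hf.self_of_nhds
  have hnez := hne.self_of_nhds
  have hp : pdxR f =ᶠ[nhds z] fun y => f y * (Q y).re := by
    filter_upwards [hne, hQe] with y h1 h2
    have h1' : (f y : ℂ) ≠ 0 := by exact_mod_cast h1
    rw [div_eq_iff h1'] at h2
    have := congrArg re h2
    simp [dzR] at this
    linarith
  have hs : pdyR f =ᶠ[nhds z] fun y => -(f y * (Q y).im) := by
    filter_upwards [hne, hQe] with y h1 h2
    have h1' : (f y : ℂ) ≠ 0 := by exact_mod_cast h1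
    rw [div_eq_iff h1'] at h2
    have := congrArg im h2
    simp [dzR] at this
    linarith
  have hre : HasFDerivAt (fun y => (Q y).re) (reCLM.comp (fderiv ℝ Q z)) z :=
    (reCLM.hasFDerivAt (x := Q z)).comp z hQ.hasFDerivAt
  have him : HasFDerivAt (fun y => (Q y).im) (imCLM.comp (fderiv ℝ Q z)) z :=
    (imCLM.hasFDerivAt (x := Q z)).comp z hQ.hasFDerivAt
  have hp' := (hfz.hasFDerivAt.mul hre).congr_of_eventuallyEq hp
  have hs' := (hfz.hasFDerivAt.mul him).neg.congr_of_eventuallyEq hs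
  have hF0 := (hp'.smul_const (𝕜' := ℝ) (F := ℂ →L[ℝ] ℝ) reCLM).add
    (hs'.smul_const (𝕜' := ℝ) (F := ℂ →L[ℝ] ℝ) imCLM)
  have hF := hF0.congr_of_eventuallyEq (f₁ := fderiv ℝ f)
    (Filter.Eventually.of_forall fun y => fderiv_real_eq f y)
  have hsym := second_derivative_symmetric_of_eventually
    (hf.mono fun y hy => hy.hasFDerivAt) hF 1 I
  have e1 := hp.self_of_nhds
  have e2 := hs.self_of_nhds
  simp only [pdxR, pdyR] at e1 e2
  simp [e1, e2] at hsym
  apply mul_left_cancel₀ hnez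
  linarith

/-- the `(F,G)`-derivative `w = ∂_z W − (∂_z f₀/f₀) conj(W)` of a solution `W`
of the main Vekua equation `∂_z̄ W = (∂_z̄ f₀/f₀) conj(W)` solves the Vekua equation
`∂_z̄ w + (∂_z f₀/f₀) conj(w) = 0`. -/
theorem FG_derivative_solves_Vekua
    (Ω : Set ℂ) (hΩ : IsOpen Ω) (f₀ : ℂ → ℝ) (W : ℂ → ℂ)
    (hf₀C1 : ContDiffOn ℝ 1 f₀ Ω)
    (hf₀ne : ∀ z ∈ Ω, f₀ z ≠ 0)
    (hWC2 : ContDiffOn ℝ 2 W Ω)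
    (hMainVekua : ∀ z ∈ Ω, dzbarC W z = dzbarR f₀ z / (f₀ z : ℂ) * conj (W z))
    (w : ℂ → ℂ)
    (hw : ∀ z ∈ Ω, w z = dzC W z - dzR f₀ z / (f₀ z : ℂ) * conj (W z)) :
    ∀ z ∈ Ω, dzbarC w z + dzR f₀ z / (f₀ z : ℂ) * conj (w z) = 0 := by
  intro z hz
  have hN : ∀ᶠ y in nhds z, y ∈ Ω := hΩ.mem_nhds hz
  have hWz : ContDiffAt ℝ 2 W z := hWC2.contDiffAt (hΩ.mem_nhds hz)
  have hfz : ContDiffAt ℝ 1 f₀ z := hf₀C1.contDiffAt (hΩ.mem_nhds hz)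
  obtain ⟨A', B', hA, hB, hAB⟩ := wirt_symm hWz
  have hWd := (hWz.differentiableAt (by norm_num)).hasFDerivAt
  set q : ℂ → ℂ := fun y => dzR f₀ y / (f₀ y : ℂ) with hq
  have hcq : ∀ y, conj (q y) = dzbarR f₀ y / (f₀ y : ℂ) := by
    intro y; simp [hq, dzR, dzbarR]
  have hBe : ∀ y ∈ Ω, dzbarC W y = conj (q y) * conj (W y) := by
    intro y hy; rw [hcq]; exact hMainVekua y hy
  have hBev : dzbarC W =ᶠ[nhds z] fun y => conj (q y) * conj (W y) := hN.mono hBe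
  have hwe : w =ᶠ[nhds z] fun y => dzC W y - q y * conj (W y) := hN.mono hw
  have hBz := hBe z hz
  have hwz : w z = dzC W z - q z * conj (W z) := hw z hz
  have hWc := hasFDerivAt_conj hWd
  change dzbarC w z + q z * conj (w z) = 0
  rw [hwz]
  simp only [dzbarC, dzC, pdxC, pdyC] at hBz ⊢
  have hBz' := congrArg conj hBz
  simp only [map_add, map_mul, conj_I, Complex.conj_conj] at hBz'
  by_cases h0 : W z = 0
  · have hfc : ContinuousAt (fderiv ℝ f₀) z :=
      (hfz.fderiv_right (m := 0) (by norm_num)).continuousAt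
    have hqc : ContinuousAt q z := by
      have h1 : ContinuousAt (fun y => (fderiv ℝ f₀ y 1 : ℝ)) z := hfc.clm_apply continuousAt_const
      have h2 : ContinuousAt (fun y => (fderiv ℝ f₀ y I : ℝ)) z := hfc.clm_apply continuousAt_const
      have h3 := hfz.continuousAt
      have hr : ∀ {g : ℂ → ℝ}, ContinuousAt g z → ContinuousAt (fun y => (g y : ℂ)) z :=
        fun h => continuous_ofReal.continuousAt.comp h
      refine ContinuousAt.div ?_ (hr h3) (by exact_mod_cast hf₀ne z hz)
      exact (hr h1).sub (continuousAt_const.mul (hr h2))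
    have hqc' : ContinuousAt (fun y => conj (q y)) z := continuous_conj.continuousAt.comp hqc
    have hwd := (hA.sub (hasFDerivAt_mul_of_zero hqc hWc (by simp [h0]))).congr_of_eventuallyEq hwe
    have hBd := (hasFDerivAt_mul_of_zero hqc' hWc (by simp [h0])).congr_of_eventuallyEq hBev
    have hBB := hB.unique hBd
    rw [hBB] at hAB
    rw [hwd.fderiv]
    simp [h0] at hAB hBz' ⊢
    linear_combination hAB + conj (q z) * hBz'
  · have hQd : DifferentiableAt ℝ (fun y => conj (dzbarC W y) / W y) z := by
      simp only [div_eq_mul_inv]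
      exact (hasFDerivAt_conj hB).differentiableAt.fun_mul (hWd.differentiableAt.fun_inv h0)
    have hQe : ∀ᶠ y in nhds z, q y = conj (dzbarC W y) / W y := by
      filter_upwards [hN, hWd.continuousAt.eventually_ne h0] with y hy h1
      rw [hBe y hy, map_mul, Complex.conj_conj, Complex.conj_conj, mul_div_cancel_right₀ _ h1]
    have hreal := q_deriv (f := f₀) (z := z)
      (hN.mono fun y hy => (hf₀C1.contDiffAt (hΩ.mem_nhds hy)).differentiableAt (by norm_num))
      (hN.mono hf₀ne) hQd hQe
    have hqd := hQd.hasFDerivAt.congr_of_eventuallyEq hQe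
    set q' := fderiv ℝ (fun y => conj (dzbarC W y) / W y) z
    have hwd := (hA.sub (hqd.mul hWc)).congr_of_eventuallyEq hwe
    have hBd := ((hasFDerivAt_conj hqd).mul hWc).congr_of_eventuallyEq hBev
    have hBB := hB.unique hBd
    rw [hBB] at hAB
    have hreal' : q' 1 + I * q' I = conj (q' 1) - I * conj (q' I) := by
      apply Complex.ext <;> simp <;> linarith
    rw [hwd.fderiv]
    simp at hAB hBz' ⊢
    linear_combination hAB + conj (q z) * hBz' - conj (W z) * hreal'
end

section
/- Let f₀ : Ω → ℝ be nonvanishing and continuously differentiable, and let w : Ω → ℂ be a continuous solution of the Vekua equation ∂_z̄ w + (∂_z f₀ / f₀)·conj(w) = 0 on Ω. Suppose P, Q : Ω → ℝ are continuously differentiable and satisfy ∂_x P = Re(w/f₀), ∂_y P = −Im(w/f₀), ∂_x Q = Im(f₀·w), ∂_y Q = Re(f₀·w) on Ω. Then the function W = (1/2)·( f₀·P + i·Q/f₀ ) is a solution of the main Vekua equation ∂_z̄ W = (∂_z̄ f₀ / f₀)·conj(W) on Ω. (W is the (F,G)-antiderivative of w for the generating pair F = f₀, G = i/f₀.) -/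
open Complex ComplexConjugate

/-- the `(F,G)`-antiderivative `W = ½(f₀ P + i Q/f₀)` of a solution `w`
of the Vekua equation `∂_z̄ w + (∂_z f₀/f₀) conj(w) = 0`, where `P` and `Q` encode the
path integrals `Re ∫ w/f₀ dζ` and `Im ∫ f₀ w dζ`, solves the main Vekua equation. -/
theorem FG_antiderivative_solves_main_Vekua
    (Ω : Set ℂ) (hΩ : IsOpen Ω) (f₀ : ℂ → ℝ) (w : ℂ → ℂ) (P Q : ℂ → ℝ)
    (hf₀C1 : ContDiffOn ℝ 1 f₀ Ω)
    (hf₀ne : ∀ z ∈ Ω, f₀ z ≠ 0)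
    (hwcont : ContinuousOn w Ω)
    (hwdiff : DifferentiableOn ℝ w Ω)
    (hVekua : ∀ z ∈ Ω, dzbarC w z + dzR f₀ z / (f₀ z : ℂ) * conj (w z) = 0)
    (hPC1 : ContDiffOn ℝ 1 P Ω) (hQC1 : ContDiffOn ℝ 1 Q Ω)
    (hPx : ∀ z ∈ Ω, pdxR P z = (w z / (f₀ z : ℂ)).re)
    (hPy : ∀ z ∈ Ω, pdyR P z = -(w z / (f₀ z : ℂ)).im)
    (hQx : ∀ z ∈ Ω, pdxR Q z = ((f₀ z : ℂ) * w z).im)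
    (hQy : ∀ z ∈ Ω, pdyR Q z = ((f₀ z : ℂ) * w z).re)
    (W : ℂ → ℂ)
    (hW : ∀ z, W z = (1 / 2 : ℂ) * ((f₀ z : ℂ) * (P z : ℂ) + Complex.I * (Q z : ℂ) / (f₀ z : ℂ))) :
    ∀ z ∈ Ω, dzbarC W z = dzbarR f₀ z / (f₀ z : ℂ) * conj (W z) := by
  intro z hz
  have hn := hf₀ne z hz
  have hnC : (f₀ z : ℂ) ≠ 0 := by exact_mod_cast hn
  have hf := ((hf₀C1.differentiableOn one_ne_zero).differentiableAt (hΩ.mem_nhds hz)).hasFDerivAt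
  have hP := ((hPC1.differentiableOn one_ne_zero).differentiableAt (hΩ.mem_nhds hz)).hasFDerivAt
  have hQ := ((hQC1.differentiableOn one_ne_zero).differentiableAt (hΩ.mem_nhds hz)).hasFDerivAt
  have key : ∀ v : ℂ, fderiv ℝ W z v = (1 / 2 : ℂ) *
      ((fderiv ℝ f₀ z v : ℂ) * P z + f₀ z * (fderiv ℝ P z v : ℂ)
        + I * ((fderiv ℝ Q z v : ℂ) / f₀ z - Q z * (fderiv ℝ f₀ z v : ℂ) / (f₀ z) ^ 2)) := by
    intro v
    have hA := Complex.ofRealCLM.hasFDerivAt.comp z (hf.mul hP)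
    have hinv := (hasDerivAt_inv hn).comp_hasFDerivAt z hf
    have hB := Complex.ofRealCLM.hasFDerivAt.comp z (hQ.mul hinv)
    have hC := (hA.add (hB.const_mul I)).const_mul (1 / 2 : ℂ)
    have hD := hC.congr_of_eventuallyEq (f₁ := W) (Filter.Eventually.of_forall fun x => by
      rw [hW]; simp [div_eq_mul_inv, mul_assoc])
    rw [hD.fderiv]
    simp
    field_simp
    ring
  have h1 := hPx z hz
  have h2 := hPy z hz
  have h3 := hQx z hz
  have h4 := hQy z hz
  simp only [pdxR, pdyR] at h1 h2 h3 h4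
  rw [Complex.div_ofReal_re] at h1
  rw [Complex.div_ofReal_im] at h2
  rw [Complex.im_ofReal_mul] at h3
  rw [Complex.re_ofReal_mul] at h4
  simp only [dzbarC, dzbarR, pdxC, pdyC, pdxR, pdyR, key, h1, h2, h3, h4, hW, map_mul, map_add,
    map_div₀, conj_I, conj_ofReal, map_one, map_ofNat]
  push_cast
  field_simp
  ring_nf
  simp only [I_sq]
  ring
end

section
/- Let ν : Ω → ℝ and let f₀ : Ω → ℝ be a nonvanishing twice continuously differentiable solution of Δ f₀ = ν f₀ on Ω. Let W : Ω → ℂ be a twice continuously differentiable solution of the main Vekua equation ∂_z̄ W = (∂_z̄ f₀ / f₀)·conj(W) on Ω, and write W = u + iv with u, v real-valued. Then u is a solution of (−Δ + ν) u = 0 on Ω, and v is a solution of (Δ + ν − 2·|∇f₀|²/f₀²) v = 0 on Ω. -/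
open Complex ComplexConjugate

theorem aux_diff_s5 {g : ℂ → ℝ} {z : ℂ} (hg : ContDiffAt ℝ 2 g z) (e : ℂ) :
    DifferentiableAt ℝ (fun w => fderiv ℝ g w e) z := by
  have h : DifferentiableAt ℝ (fderiv ℝ g) z :=
    (hg.fderiv_right (m := 1) (by norm_num)).differentiableAt (by norm_num)
  exact h.clm_apply (differentiableAt_const e)

theorem aux_symm {g : ℂ → ℝ} {z : ℂ} (hg : ContDiffAt ℝ 2 g z) (a b : ℂ) :
    fderiv ℝ (fun w => fderiv ℝ g w a) z b = fderiv ℝ (fun w => fderiv ℝ g w b) z a := by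
  have h : DifferentiableAt ℝ (fderiv ℝ g) z :=
    (hg.fderiv_right (m := 1) (by norm_num)).differentiableAt (by norm_num)
  have key : ∀ e e' : ℂ, fderiv ℝ (fun w => fderiv ℝ g w e) z e' = fderiv ℝ (fderiv ℝ g) z e' e := by
    intro e e'
    rw [fderiv_clm_apply h (differentiableAt_const e)]
    simp
  rw [key, key]
  exact (hg.isSymmSndFDerivAt (by simp)) b a

/-- Differentiating `f * (p + s q) = r u + t v`. -/
theorem aux_deriv {f p q r t u v : ℂ → ℝ} {s c : ℝ} {z : ℂ} (e : ℂ)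
    (hf : DifferentiableAt ℝ f z) (hp : DifferentiableAt ℝ p z) (hq : DifferentiableAt ℝ q z)
    (hr : DifferentiableAt ℝ r z) (ht : DifferentiableAt ℝ t z) (hu : DifferentiableAt ℝ u z)
    (hv : DifferentiableAt ℝ v z)
    (h : (fun w => f w * (p w + s * q w)) =ᶠ[nhds z] fun w => r w * u w + c * (t w * v w)) :
    fderiv ℝ f z e * (p z + s * q z) + f z * (fderiv ℝ p z e + s * fderiv ℝ q z e) =
      fderiv ℝ r z e * u z + r z * fderiv ℝ u z e
        + c * (fderiv ℝ t z e * v z + t z * fderiv ℝ v z e) := by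
  have h1 := hf.hasFDerivAt.mul (hp.hasFDerivAt.add (hq.hasFDerivAt.const_mul s))
  have h2 := (hr.hasFDerivAt.mul hu.hasFDerivAt).add
    ((ht.hasFDerivAt.mul hv.hasFDerivAt).const_mul c)
  have h3 := (h1.congr_of_eventuallyEq h.symm).unique h2
  have h4 := congrArg (fun L : ℂ →L[ℝ] ℝ => L e) h3
  simp at h4
  linarith

/-- for a solution `W = u + iv` of the main Vekua equation
`∂_z̄ W = (∂_z̄ f₀/f₀) conj(W)`, the real part `u` solves `(−Δ + ν)u = 0` and the imaginary
part `v` solves `(Δ + ν − 2|∇f₀|²/f₀²)v = 0` (the Darboux-transformed equation). -/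
theorem main_Vekua_real_and_imaginary_parts
    (Ω : Set ℂ) (hΩ : IsOpen Ω) (ν f₀ : ℂ → ℝ) (W : ℂ → ℂ)
    (hf₀C2 : ContDiffOn ℝ 2 f₀ Ω)
    (hf₀ne : ∀ z ∈ Ω, f₀ z ≠ 0)
    (hf₀sol : ∀ z ∈ Ω, lapR f₀ z = ν z * f₀ z)
    (hWC2 : ContDiffOn ℝ 2 W Ω)
    (hMainVekua : ∀ z ∈ Ω, dzbarC W z = dzbarR f₀ z / (f₀ z : ℂ) * conj (W z)) :
    (∀ z ∈ Ω, -lapR (fun ζ => (W ζ).re) z + ν z * (W z).re = 0) ∧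
    (∀ z ∈ Ω, lapR (fun ζ => (W ζ).im) z + ν z * (W z).im
        - 2 * gradNormSq f₀ z / (f₀ z) ^ 2 * (W z).im = 0) := by
  have main : ∀ z ∈ Ω, (-lapR (fun ζ => (W ζ).re) z + ν z * (W z).re = 0) ∧
      (lapR (fun ζ => (W ζ).im) z + ν z * (W z).im
        - 2 * gradNormSq f₀ z / (f₀ z) ^ 2 * (W z).im = 0) := by
    have hre : ∀ z ∈ Ω, ∀ e, fderiv ℝ (fun ζ => (W ζ).re) z e = (fderiv ℝ W z e).re := by
      intro z hz e
      have hW := ((hWC2.contDiffAt (hΩ.mem_nhds hz)).differentiableAt (by norm_num)).hasFDerivAt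
      have := (Complex.reCLM.hasFDerivAt.comp z hW).fderiv
      exact congrArg (fun L : ℂ →L[ℝ] ℝ => L e) this
    have him : ∀ z ∈ Ω, ∀ e, fderiv ℝ (fun ζ => (W ζ).im) z e = (fderiv ℝ W z e).im := by
      intro z hz e
      have hW := ((hWC2.contDiffAt (hΩ.mem_nhds hz)).differentiableAt (by norm_num)).hasFDerivAt
      have := (Complex.imCLM.hasFDerivAt.comp z hW).fderiv
      exact congrArg (fun L : ℂ →L[ℝ] ℝ => L e) this
    set u : ℂ → ℝ := fun ζ => (W ζ).re with hu
    set v : ℂ → ℝ := fun ζ => (W ζ).im with hv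
    have hE : ∀ w ∈ Ω,
        f₀ w * (fderiv ℝ u w 1 + (-1) * fderiv ℝ v w I)
          = fderiv ℝ f₀ w 1 * u w + 1 * (fderiv ℝ f₀ w I * v w) ∧
        f₀ w * (fderiv ℝ u w I + 1 * fderiv ℝ v w 1)
          = fderiv ℝ f₀ w I * u w + (-1) * (fderiv ℝ f₀ w 1 * v w) := by
      intro w hw
      have h0 : (f₀ w : ℂ) ≠ 0 := by exact_mod_cast hf₀ne w hw
      have h := hMainVekua w hw
      rw [div_mul_eq_mul_div, eq_div_iff h0] at h
      have h1 := congrArg Complex.re h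
      have h2 := congrArg Complex.im h
      simp [dzbarC, dzbarR, pdxC, pdyC, pdxR, pdyR] at h1 h2
      rw [hre w hw, him w hw, hre w hw, him w hw]
      simp only [hu, hv]
      constructor <;> linarith
    intro z hz
    have hn := hΩ.mem_nhds hz
    have cf := hf₀C2.contDiffAt hn
    have cW := hWC2.contDiffAt hn
    have cu : ContDiffAt ℝ 2 u z := Complex.reCLM.contDiff.contDiffAt.comp z cW
    have cv : ContDiffAt ℝ 2 v z := Complex.imCLM.contDiff.contDiffAt.comp z cW
    have df := cf.differentiableAt (by norm_num)
    have du := cu.differentiableAt (by norm_num)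
    have dv := cv.differentiableAt (by norm_num)
    have D1 := fun e => aux_deriv e df (aux_diff_s5 cu 1) (aux_diff_s5 cv I) (aux_diff_s5 cf 1)
      (aux_diff_s5 cf I) du dv (Filter.eventuallyEq_of_mem hn fun w hw => (hE w hw).1)
    have D2 := fun e => aux_deriv e df (aux_diff_s5 cu I) (aux_diff_s5 cv 1) (aux_diff_s5 cf I)
      (aux_diff_s5 cf 1) du dv (Filter.eventuallyEq_of_mem hn fun w hw => (hE w hw).2)
    have a1 := D1 1
    have a2 := D1 I
    have b1 := D2 1
    have b2 := D2 I
    obtain ⟨e1, e2⟩ := hE z hz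
    have su := aux_symm cu 1 I
    have sv := aux_symm cv 1 I
    have sf := aux_symm cf 1 I
    have h0 := hf₀ne z hz
    have hs := hf₀sol z hz
    have hux : u z = (W z).re := rfl
    have hvx : v z = (W z).im := rfl
    rw [← hux, ← hvx]
    simp only [lapR, gradNormSq]
    simp only [lapR] at hs
    unfold pdxR pdyR at *
    rw [su] at a2
    rw [sv] at b2
    rw [sf] at a2 b2
    generalize fderiv ℝ (fun z => fderiv ℝ u z 1) z 1 = uxx at *
    generalize fderiv ℝ (fun z => fderiv ℝ u z I) z I = uyy at *
    generalize fderiv ℝ (fun z => fderiv ℝ u z I) z 1 = uxy at *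
    generalize fderiv ℝ (fun z => fderiv ℝ v z 1) z 1 = vxx at *
    generalize fderiv ℝ (fun z => fderiv ℝ v z I) z I = vyy at *
    generalize fderiv ℝ (fun z => fderiv ℝ v z I) z 1 = vxy at *
    generalize fderiv ℝ (fun z => fderiv ℝ f₀ z 1) z 1 = fxx at *
    generalize fderiv ℝ (fun z => fderiv ℝ f₀ z I) z I = fyy at *
    generalize fderiv ℝ (fun z => fderiv ℝ f₀ z I) z 1 = fxy at *
    generalize fderiv ℝ u z 1 = ux at *
    generalize fderiv ℝ u z I = uy at *
    generalize fderiv ℝ v z 1 = vx at *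
    generalize fderiv ℝ v z I = vy at *
    generalize fderiv ℝ f₀ z 1 = fx at *
    generalize fderiv ℝ f₀ z I = fy at *
    generalize f₀ z = f at *
    generalize u z = U at *
    generalize v z = V at *
    generalize ν z = n at *
    clear D1 D2
    constructor
    · apply mul_left_cancel₀ h0
      linear_combination -a1 - b2 - U * hs
    · apply mul_left_cancel₀ (pow_ne_zero 2 h0)
      field_simp
      linear_combination f * (b1 - a2) + 2 * fy * e1 - 2 * fx * e2 - f * V * hs
  exact ⟨fun z hz => (main z hz).1, fun z hz => (main z hz).2⟩
end

section
/- Let ν : Ω → ℝ, let f₀ : Ω → ℝ be a nonvanishing twice continuously differentiable solution of Δ f₀ = ν f₀ on Ω, and let u : Ω → ℝ be a twice continuously differentiable solution of Δ u = ν u on Ω. Then the divergence identity ∂_x( f₀² · ∂_x(u/f₀) ) + ∂_y( f₀² · ∂_y(u/f₀) ) = 0 holds on Ω; equivalently, the expression i·f₀²·∂_z̄(u/f₀) satisfies the compatibility condition guaranteeing existence of a real-valued antigradient for the operator ∂_z̄. -/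
open Complex ComplexConjugate

theorem aux_dir (Ω : Set ℂ) (hΩ : IsOpen Ω) (f u : ℂ → ℝ)
    (hf : ContDiffOn ℝ 2 f Ω) (hne : ∀ z ∈ Ω, f z ≠ 0) (hu : ContDiffOn ℝ 2 u Ω)
    (v z : ℂ) (hz : z ∈ Ω) :
    fderiv ℝ (fun ζ => f ζ ^ 2 * fderiv ℝ (fun w => u w / f w) ζ v) z v
      = f z * fderiv ℝ (fun ζ => fderiv ℝ u ζ v) z v
        - u z * fderiv ℝ (fun ζ => fderiv ℝ f ζ v) z v := by
  have d1 : ∀ g : ℂ → ℝ, ContDiffOn ℝ 2 g Ω → ∀ w ∈ Ω, DifferentiableAt ℝ g w := by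
    intro g hg w hw
    exact (hg.contDiffAt (hΩ.mem_nhds hw)).differentiableAt (by norm_num)
  have d2 : ∀ g : ℂ → ℝ, ContDiffOn ℝ 2 g Ω →
      DifferentiableAt ℝ (fun ζ => fderiv ℝ g ζ v) z := by
    intro g hg
    have h1 : ContDiffAt ℝ 1 (fderiv ℝ g) z :=
      (hg.contDiffAt (hΩ.mem_nhds hz)).fderiv_right (by norm_num)
    exact (h1.differentiableAt (by norm_num)).clm_apply (differentiableAt_const v)
  have e : (fun ζ => f ζ ^ 2 * fderiv ℝ (fun w => u w / f w) ζ v) =ᶠ[nhds z]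
      (fun ζ => f ζ * fderiv ℝ u ζ v - u ζ * fderiv ℝ f ζ v) := by
    filter_upwards [hΩ.mem_nhds hz] with ζ hζ
    have hn := hne ζ hζ
    have h := ((d1 u hu ζ hζ).hasFDerivAt.mul
      ((hasDerivAt_inv hn).comp_hasFDerivAt ζ (d1 f hf ζ hζ).hasFDerivAt))
    have h' : HasFDerivAt (fun w => u w / f w) _ ζ := h
    rw [h'.fderiv]
    simp
    field_simp
    ring
  rw [e.fderiv_eq]
  have h := ((d1 f hf z hz).hasFDerivAt.mul (d2 u hu).hasFDerivAt).sub
    ((d1 u hu z hz).hasFDerivAt.mul (d2 f hf).hasFDerivAt)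
  have h' : HasFDerivAt (fun ζ => f ζ * fderiv ℝ u ζ v - u ζ * fderiv ℝ f ζ v) _ z := h
  rw [h'.fderiv]
  simp
  ring

/-- if `Δf₀ = ν f₀` and `Δu = ν u`, then the divergence identity
`∂_x(f₀² ∂_x(u/f₀)) + ∂_y(f₀² ∂_y(u/f₀)) = 0` holds, i.e. `i f₀² ∂_z̄(u/f₀)` satisfies
the compatibility condition for the existence of a real antigradient for `∂_z̄`. -/
theorem divergence_identity_compatibility
    (Ω : Set ℂ) (hΩ : IsOpen Ω) (ν f₀ u : ℂ → ℝ)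
    (hf₀C2 : ContDiffOn ℝ 2 f₀ Ω)
    (hf₀ne : ∀ z ∈ Ω, f₀ z ≠ 0)
    (hf₀sol : ∀ z ∈ Ω, lapR f₀ z = ν z * f₀ z)
    (huC2 : ContDiffOn ℝ 2 u Ω)
    (husol : ∀ z ∈ Ω, lapR u z = ν z * u z) :
    ∀ z ∈ Ω,
      pdxR (fun ζ => f₀ ζ ^ 2 * pdxR (fun w => u w / f₀ w) ζ) z
        + pdyR (fun ζ => f₀ ζ ^ 2 * pdyR (fun w => u w / f₀ w) ζ) z = 0 := by
  intro z hz
  have h1 := aux_dir Ω hΩ f₀ u hf₀C2 hf₀ne huC2 1 z hz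
  have h2 := aux_dir Ω hΩ f₀ u hf₀C2 hf₀ne huC2 Complex.I z hz
  have a := hf₀sol z hz
  have b := husol z hz
  unfold lapR at a b
  unfold pdxR pdyR at *
  rw [h1, h2]
  linear_combination f₀ z * b - u z * a
end

section
/- Let ν : Ω → ℝ, let f₀ : Ω → ℝ be a nonvanishing twice continuously differentiable solution of Δ f₀ = ν f₀ on Ω, and let u : Ω → ℝ be a twice continuously differentiable solution of Δ u = ν u on Ω. Suppose ψ : Ω → ℝ is twice continuously differentiable with ∂_z̄ ψ = i·f₀²·∂_z̄(u/f₀) on Ω, and set v = ψ/f₀. Then W = u + i·v is a solution of the main Vekua equation ∂_z̄ W = (∂_z̄ f₀ / f₀)·conj(W) on Ω, and consequently v is a solution of (Δ + ν − 2·|∇f₀|²/f₀²) v = 0 on Ω. -/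
open Complex ComplexConjugate

theorem aux_snd {f : ℂ → ℝ} {z : ℂ} (h : ContDiffAt ℝ 2 f z) (e : ℂ) :
    HasFDerivAt (fun w => fderiv ℝ f w e) ((fderiv ℝ (fderiv ℝ f) z).flip e) z := by
  have h1 : DifferentiableAt ℝ (fderiv ℝ f) z :=
    (h.fderiv_right (m := 1) (by norm_num)).differentiableAt (by norm_num)
  have := h1.hasFDerivAt.clm_apply (hasFDerivAt_const e z)
  simpa using this

theorem aux_symm_s7 {f : ℂ → ℝ} {z : ℂ} (h : ContDiffAt ℝ 2 f z) (a b : ℂ) :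
    fderiv ℝ (fderiv ℝ f) z a b = fderiv ℝ (fderiv ℝ f) z b a :=
  (h.isSymmSndFDerivAt (by simp)) a b

theorem aux_diff_s7 {g a b c k m n p : ℂ → ℝ} {z : ℂ} {g' a' b' c' k' m' n' p' : ℂ →L[ℝ] ℝ}
    (hg : HasFDerivAt g g' z) (ha : HasFDerivAt a a' z) (hb : HasFDerivAt b b' z)
    (hc : HasFDerivAt c c' z) (hk : HasFDerivAt k k' z) (hm : HasFDerivAt m m' z)
    (hn : HasFDerivAt n n' z) (hp : HasFDerivAt p p' z)
    (h : (fun w => g w * a w + b w * c w) =ᶠ[nhds z] (fun w => k w * m w + n w * p w)) (e : ℂ) :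
    g z * a' e + a z * g' e + (b z * c' e + c z * b' e)
      = k z * m' e + m z * k' e + (n z * p' e + p z * n' e) := by
  have h1 := (hg.mul ha).add (hb.mul hc)
  have h2 := (hk.mul hm).add (hn.mul hp)
  have h3 := h1.unique (h2.congr_of_eventuallyEq h)
  have := congrArg (fun L : ℂ →L[ℝ] ℝ => L e) h3
  simpa using this

/-- two-dimensional Darboux transformation, direct direction: given a solution
`u` of `Δu = νu`, a real `ψ` with `∂_z̄ ψ = i f₀² ∂_z̄(u/f₀)`, and `v = ψ/f₀`, the function
`W = u + iv` solves the main Vekua equation, and `v` solves `(Δ + ν − 2|∇f₀|²/f₀²)v = 0`. -/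
theorem darboux_transformation_direct
    (Ω : Set ℂ) (hΩ : IsOpen Ω) (ν f₀ u ψ : ℂ → ℝ)
    (hf₀C2 : ContDiffOn ℝ 2 f₀ Ω)
    (hf₀ne : ∀ z ∈ Ω, f₀ z ≠ 0)
    (hf₀sol : ∀ z ∈ Ω, lapR f₀ z = ν z * f₀ z)
    (huC2 : ContDiffOn ℝ 2 u Ω)
    (husol : ∀ z ∈ Ω, lapR u z = ν z * u z)
    (hψC2 : ContDiffOn ℝ 2 ψ Ω)
    (hψ : ∀ z ∈ Ω, dzbarR ψ z = Complex.I * (f₀ z : ℂ) ^ 2 * dzbarR (fun w => u w / f₀ w) z)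
    (v : ℂ → ℝ) (hv : ∀ z, v z = ψ z / f₀ z)
    (W : ℂ → ℂ) (hW : ∀ z, W z = (u z : ℂ) + Complex.I * (v z : ℂ)) :
    (∀ z ∈ Ω, dzbarC W z = dzbarR f₀ z / (f₀ z : ℂ) * conj (W z)) ∧
    (∀ z ∈ Ω, lapR v z + ν z * v z - 2 * gradNormSq f₀ z / (f₀ z) ^ 2 * v z = 0) := by
  obtain rfl : v = fun z => ψ z / f₀ z := funext hv
  obtain rfl : W = fun z => (u z : ℂ) + Complex.I * ((ψ z / f₀ z : ℝ) : ℂ) := funext hW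
  set v : ℂ → ℝ := fun z => ψ z / f₀ z with hvdef
  have cf : ∀ z ∈ Ω, ContDiffAt ℝ 2 f₀ z := fun z hz => hf₀C2.contDiffAt (hΩ.mem_nhds hz)
  have cu : ∀ z ∈ Ω, ContDiffAt ℝ 2 u z := fun z hz => huC2.contDiffAt (hΩ.mem_nhds hz)
  have cψ : ∀ z ∈ Ω, ContDiffAt ℝ 2 ψ z := fun z hz => hψC2.contDiffAt (hΩ.mem_nhds hz)
  have cv : ∀ z ∈ Ω, ContDiffAt ℝ 2 v z := fun z hz => (cψ z hz).div (cf z hz) (hf₀ne z hz)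
  have d : ∀ {g : ℂ → ℝ} {z : ℂ}, ContDiffAt ℝ 2 g z → HasFDerivAt g (fderiv ℝ g z) z :=
    fun h => (h.differentiableAt (by norm_num)).hasFDerivAt
  have hdiv : ∀ z ∈ Ω, ∀ g : ℂ → ℝ, ContDiffAt ℝ 2 g z → ∀ e,
      fderiv ℝ g z e = f₀ z * fderiv ℝ (fun w => g w / f₀ w) z e
        + g z / f₀ z * fderiv ℝ f₀ z e := by
    intro z hz g hg e
    have h1 := (d (cf z hz)).mul (d (hg.div (cf z hz) (hf₀ne z hz)))
    have h2 : g =ᶠ[nhds z] (fun w => f₀ w * (g w / f₀ w)) := by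
      filter_upwards [hΩ.mem_nhds hz] with w hw
      have := hf₀ne w hw
      field_simp
    have h3 := (d hg).unique (h1.congr_of_eventuallyEq h2)
    have := congrArg (fun L : ℂ →L[ℝ] ℝ => L e) h3
    simp only [ContinuousLinearMap.add_apply, ContinuousLinearMap.smul_apply, smul_eq_mul] at this
    exact this
  have key : ∀ z ∈ Ω,
      f₀ z * fderiv ℝ v z 1 + f₀ z * fderiv ℝ u z I = u z * fderiv ℝ f₀ z I - v z * fderiv ℝ f₀ z 1 ∧
      f₀ z * fderiv ℝ u z 1 - f₀ z * fderiv ℝ v z I = u z * fderiv ℝ f₀ z 1 + v z * fderiv ℝ f₀ z I := by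
    intro z hz
    have hne := hf₀ne z hz
    have h := hψ z hz
    have hx := hdiv z hz ψ (cψ z hz) 1
    have hy := hdiv z hz ψ (cψ z hz) I
    have ux := hdiv z hz u (cu z hz) 1
    have uy := hdiv z hz u (cu z hz) I
    have hre := congrArg Complex.re h
    have him := congrArg Complex.im h
    have q1 : ((f₀ z : ℂ) ^ 2).re = f₀ z ^ 2 := by
      rw [← Complex.ofReal_pow, Complex.ofReal_re]
    have q2 : ((f₀ z : ℂ) ^ 2).im = 0 := by
      rw [← Complex.ofReal_pow, Complex.ofReal_im]
    simp only [dzbarR, pdxR, pdyR] at hre him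
    simp [q1, q2] at hre him
    change fderiv ℝ ψ z 1 = f₀ z * fderiv ℝ v z 1 + v z * fderiv ℝ f₀ z 1 at hx
    change fderiv ℝ ψ z I = f₀ z * fderiv ℝ v z I + v z * fderiv ℝ f₀ z I at hy
    have hu : u z / f₀ z * f₀ z = u z := by field_simp
    generalize u z / f₀ z = q at *
    constructor
    · linear_combination -hx + hre + f₀ z * uy + fderiv ℝ f₀ z I * hu
    · linear_combination hy - him + f₀ z * ux + fderiv ℝ f₀ z 1 * hu
  refine ⟨fun z hz => ?_, fun z hz => ?_⟩
  · obtain ⟨k1, k2⟩ := key z hz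
    have hne := hf₀ne z hz
    have hneC : (f₀ z : ℂ) ≠ 0 := by exact_mod_cast hne
    have hW' : HasFDerivAt (fun z => (u z : ℂ) + Complex.I * ((v z : ℝ) : ℂ))
        (Complex.ofRealCLM.comp (fderiv ℝ u z)
          + Complex.I • Complex.ofRealCLM.comp (fderiv ℝ v z)) z :=
      (Complex.ofRealCLM.hasFDerivAt.comp z (d (cu z hz))).add
        ((Complex.ofRealCLM.hasFDerivAt.comp z (d (cv z hz))).const_mul Complex.I)
    simp only [dzbarC, pdxC, pdyC, dzbarR, pdxR, pdyR]
    rw [hW'.fderiv, div_mul_eq_mul_div, eq_div_iff hneC]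
    change _ = _ * conj ((u z : ℂ) + Complex.I * (v z : ℂ))
    apply Complex.ext
    · simp
      linear_combination k2
    · simp
      linear_combination k1
  · have hne := hf₀ne z hz
    obtain ⟨k1, k2⟩ := key z hz
    have e1 := aux_diff_s7 (d (cf z hz)) ((aux_snd (cv z hz) 1).add (aux_snd (cu z hz) I))
      (d (cv z hz)) (aux_snd (cf z hz) 1) (d (cu z hz)) (aux_snd (cf z hz) I)
      (hasFDerivAt_const (0:ℝ) z) (hasFDerivAt_const (0:ℝ) z)
      (by filter_upwards [hΩ.mem_nhds hz] with w hw
          have := (key w hw).1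
          simp only [Pi.add_apply]
          linear_combination this) 1
    have e2 := aux_diff_s7 (d (cf z hz)) ((aux_snd (cu z hz) 1).sub (aux_snd (cv z hz) I))
      (hasFDerivAt_const (0:ℝ) z) (hasFDerivAt_const (0:ℝ) z)
      (d (cu z hz)) (aux_snd (cf z hz) 1) (d (cv z hz)) (aux_snd (cf z hz) I)
      (by filter_upwards [hΩ.mem_nhds hz] with w hw
          have := (key w hw).2
          simp only [Pi.sub_apply]
          linear_combination this) I
    have lap : ∀ g : ℂ → ℝ, ContDiffAt ℝ 2 g z → lapR g z =
        fderiv ℝ (fderiv ℝ g) z 1 1 + fderiv ℝ (fderiv ℝ g) z I I := by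
      intro g hg
      have a1 : fderiv ℝ (pdxR g) z = _ := (aux_snd hg 1).fderiv
      have a2 : fderiv ℝ (pdyR g) z = _ := (aux_snd hg I).fderiv
      simp only [lapR]
      rw [pdxR, pdyR, a1, a2]
      simp
    have lf := hf₀sol z hz
    rw [lap _ (cf z hz)] at lf
    rw [lap _ (cv z hz)]
    have su := aux_symm_s7 (cu z hz) 1 I
    have sf := aux_symm_s7 (cf z hz) 1 I
    simp at e1 e2
    simp only [gradNormSq, pdxR, pdyR]
    rw [su, sf] at e1
    generalize v z = V at *
    field_simp
    linear_combination f₀ z * e1 - f₀ z * e2 - f₀ z * V * lf - 2 * fderiv ℝ f₀ z 1 * k1 + 2 * fderiv ℝ f₀ z I * k2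
end

section
/- Let f₀ : Ω → ℝ be nonvanishing and continuously differentiable, and let Φ = φ + iψ : Ω → ℂ be continuously differentiable (φ, ψ real-valued). Then the following are equivalent on Ω: (i) both ∂_y(φ/f₀) − ∂_x(ψ/f₀) = 0 and ∂_x(f₀·φ) + ∂_y(f₀·ψ) = 0 hold (i.e., the expressions f₀^{−1}Φ and i f₀ Φ both admit real-valued antigradients with respect to ∂_z̄); (ii) conj(Φ) satisfies the Vekua equation ∂_z̄( conj(Φ) ) = −(∂_z f₀ / f₀)·Φ. -/
open Complex ComplexConjugate

/-- for `Φ = φ + iψ`, the two compatibility conditions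
`∂_y(φ/f₀) − ∂_x(ψ/f₀) = 0` and `∂_x(f₀ φ) + ∂_y(f₀ ψ) = 0` (existence of real
antigradients for `f₀⁻¹Φ` and `i f₀ Φ`) hold if and only if `conj(Φ)` satisfies the Vekua
equation `∂_z̄(conj Φ) = −(∂_z f₀/f₀) Φ`. -/
theorem compatibility_iff_conj_solves_Vekua
    (Ω : Set ℂ) (hΩ : IsOpen Ω) (f₀ φ ψ : ℂ → ℝ)
    (hf₀C1 : ContDiffOn ℝ 1 f₀ Ω)
    (hf₀ne : ∀ z ∈ Ω, f₀ z ≠ 0)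
    (hφC1 : ContDiffOn ℝ 1 φ Ω) (hψC1 : ContDiffOn ℝ 1 ψ Ω)
    (Φ : ℂ → ℂ) (hΦ : ∀ z, Φ z = (φ z : ℂ) + Complex.I * (ψ z : ℂ)) :
    ∀ z ∈ Ω,
      ((pdyR (fun w => φ w / f₀ w) z - pdxR (fun w => ψ w / f₀ w) z = 0 ∧
        pdxR (fun w => f₀ w * φ w) z + pdyR (fun w => f₀ w * ψ w) z = 0)
      ↔ dzbarC (fun w => conj (Φ w)) z = -(dzR f₀ z / (f₀ z : ℂ)) * Φ z) := by
  intro z hz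
  have hf : DifferentiableAt ℝ f₀ z :=
    (hf₀C1.differentiableOn (by norm_num)).differentiableAt (hΩ.mem_nhds hz)
  have hp : DifferentiableAt ℝ φ z :=
    (hφC1.differentiableOn (by norm_num)).differentiableAt (hΩ.mem_nhds hz)
  have hs : DifferentiableAt ℝ ψ z :=
    (hψC1.differentiableOn (by norm_num)).differentiableAt (hΩ.mem_nhds hz)
  have h0 := hf₀ne z hz
  have hdiv : ∀ g : ℂ → ℝ, DifferentiableAt ℝ g z → ∀ v : ℂ,
      fderiv ℝ (fun w => g w / f₀ w) z v
        = (fderiv ℝ g z v * f₀ z - g z * fderiv ℝ f₀ z v) / (f₀ z) ^ 2 := by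
    intro g hg v
    have hinv : HasFDerivAt (fun w => (f₀ w)⁻¹) ((-((f₀ z) ^ 2)⁻¹) • fderiv ℝ f₀ z) z :=
      (hasDerivAt_inv h0).comp_hasFDerivAt z hf.hasFDerivAt
    have h := (hg.hasFDerivAt.mul hinv).fderiv
    have e : (fun w => g w / f₀ w) = g * (fun w => (f₀ w)⁻¹) := by
      funext w; simp [div_eq_mul_inv]
    rw [e, h]
    simp only [add_apply, smul_apply, smul_eq_mul]
    field_simp
    ring
  have hmul : ∀ g : ℂ → ℝ, DifferentiableAt ℝ g z → ∀ v : ℂ,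
      fderiv ℝ (fun w => f₀ w * g w) z v
        = f₀ z * fderiv ℝ g z v + g z * fderiv ℝ f₀ z v := by
    intro g hg v
    have h := (hf.hasFDerivAt.mul hg.hasFDerivAt).fderiv
    have e : (fun w => f₀ w * g w) = f₀ * g := rfl
    rw [e, h]
    simp
  have hconj : ∀ v : ℂ, fderiv ℝ (fun w => conj (Φ w)) z v
      = (fderiv ℝ φ z v : ℂ) - Complex.I * (fderiv ℝ ψ z v : ℂ) := by
    intro v
    have e : (fun w => conj (Φ w)) = fun w => (φ w : ℂ) - Complex.I * (ψ w : ℂ) := by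
      funext w
      simp [hΦ, sub_eq_add_neg]
    have h1 : HasFDerivAt (fun w => (φ w : ℂ)) (Complex.ofRealCLM.comp (fderiv ℝ φ z)) z :=
      Complex.ofRealCLM.hasFDerivAt.comp z hp.hasFDerivAt
    have h2 : HasFDerivAt (fun w => (ψ w : ℂ)) (Complex.ofRealCLM.comp (fderiv ℝ ψ z)) z :=
      Complex.ofRealCLM.hasFDerivAt.comp z hs.hasFDerivAt
    rw [e, (h1.fun_sub (h2.const_mul Complex.I)).fderiv]
    simp
  simp only [pdyR, pdxR, dzbarC, dzR, pdxC, pdyC, hdiv φ hp, hdiv ψ hs, hmul φ hp, hmul ψ hs,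
    hconj, hΦ z]
  generalize fderiv ℝ φ z 1 = px
  generalize fderiv ℝ φ z Complex.I = py
  generalize fderiv ℝ ψ z 1 = sx
  generalize fderiv ℝ ψ z Complex.I = sy
  generalize fderiv ℝ f₀ z 1 = fx
  generalize fderiv ℝ f₀ z Complex.I = fy
  generalize φ z = p
  generalize ψ z = s
  generalize f₀ z = f at h0
  have hfc : (f : ℂ) ≠ 0 := by exact_mod_cast h0
  have key : ((px : ℂ) - Complex.I * sx + Complex.I * (py - Complex.I * sy)
      = -((fx - Complex.I * fy) / f) * (p + Complex.I * s)) ↔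
      (((f * px + p * fx + (f * sy + s * fy) : ℝ) : ℂ)
        + ((py * f - p * fy - (sx * f - s * fx) : ℝ) : ℂ) * Complex.I = 0) := by
    rw [← sub_eq_zero, ← mul_right_inj' hfc, mul_zero]
    have : (f : ℂ) * ((px : ℂ) - Complex.I * sx + Complex.I * (py - Complex.I * sy)
      - -((fx - Complex.I * fy) / f) * (p + Complex.I * s)) = ((f * px + p * fx + (f * sy + s * fy) : ℝ) : ℂ)
        + ((py * f - p * fy - (sx * f - s * fx) : ℝ) : ℂ) * Complex.I := by
      push_cast
      field_simp
      linear_combination (-(f : ℂ) * sy - s * fy) * Complex.I_sq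
    rw [this]
  rw [key, Complex.ext_iff, ← sub_div, div_eq_zero_iff]
  simp [h0]
  tauto
end

section
/- Let f₀ : Ω → ℝ be nonvanishing and continuously differentiable, and let Φ : Ω → ℂ be continuous. Suppose p, q : Ω → ℝ are continuously differentiable with ∂_z̄ p = Φ/f₀ and ∂_z̄ q = i·f₀·Φ on Ω. Then the function W = (1/2)·( f₀·p + i·q/f₀ ) is a solution of the main Vekua equation ∂_z̄ W = (∂_z̄ f₀ / f₀)·conj(W) on Ω. -/
open Complex ComplexConjugate

/-- if `p` and `q` are real antigradients, `∂_z̄ p = Φ/f₀` and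
`∂_z̄ q = i f₀ Φ`, then `W = ½(f₀ p + i q/f₀)` (the image `HΦ` of the paper's operator `H`)
solves the main Vekua equation `∂_z̄ W = (∂_z̄ f₀/f₀) conj(W)`. -/
theorem H_operator_solves_main_Vekua
    (Ω : Set ℂ) (hΩ : IsOpen Ω) (f₀ : ℂ → ℝ) (Φ : ℂ → ℂ) (p q : ℂ → ℝ)
    (hf₀C1 : ContDiffOn ℝ 1 f₀ Ω)
    (hf₀ne : ∀ z ∈ Ω, f₀ z ≠ 0)
    (hΦcont : ContinuousOn Φ Ω)
    (hpC1 : ContDiffOn ℝ 1 p Ω) (hqC1 : ContDiffOn ℝ 1 q Ω)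
    (hp : ∀ z ∈ Ω, dzbarR p z = Φ z / (f₀ z : ℂ))
    (hq : ∀ z ∈ Ω, dzbarR q z = Complex.I * (f₀ z : ℂ) * Φ z)
    (W : ℂ → ℂ)
    (hW : ∀ z, W z = (1 / 2 : ℂ) * ((f₀ z : ℂ) * (p z : ℂ) + Complex.I * (q z : ℂ) / (f₀ z : ℂ))) :
    ∀ z ∈ Ω, dzbarC W z = dzbarR f₀ z / (f₀ z : ℂ) * conj (W z) := by
  intro z hz
  have hne := hf₀ne z hz
  have hneC : (f₀ z : ℂ) ≠ 0 := by exact_mod_cast hne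
  have df := ((hf₀C1.differentiableOn one_ne_zero).differentiableAt (hΩ.mem_nhds hz)).hasFDerivAt
  have dp := ((hpC1.differentiableOn one_ne_zero).differentiableAt (hΩ.mem_nhds hz)).hasFDerivAt
  have dq := ((hqC1.differentiableOn one_ne_zero).differentiableAt (hΩ.mem_nhds hz)).hasFDerivAt
  have di := (hasDerivAt_inv hne).comp_hasFDerivAt z df
  have du := Complex.ofRealCLM.hasFDerivAt.comp z (df.mul dp)
  have dv := Complex.ofRealCLM.hasFDerivAt.comp z (dq.mul di)
  have dW := (du.add (dv.const_mul Complex.I)).const_mul (1 / 2 : ℂ)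
  have hWe : W = fun z => (1 / 2 : ℂ) * ((Complex.ofRealCLM ∘ (fun y => f₀ y * p y)) z
      + Complex.I * (Complex.ofRealCLM ∘ (fun y => q y * (f₀ y)⁻¹)) z) := by
    funext y
    rw [hW y]
    simp [div_eq_mul_inv, mul_assoc]
  have hd := (show HasFDerivAt W _ z from hWe ▸ dW).fderiv
  have h1 := hp z hz
  have h2 := hq z hz
  have hconj : conj (W z) = (1 / 2 : ℂ) * ((f₀ z : ℂ) * (p z : ℂ)
      - Complex.I * (q z : ℂ) / (f₀ z : ℂ)) := by
    rw [hW z]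
    simp [Complex.conj_ofReal, sub_eq_add_neg, neg_div]
    exact Or.inl (Complex.conj_ofNat 2)
  rw [hconj]
  unfold dzbarC pdxC pdyC
  rw [hd]
  unfold dzbarR pdxR pdyR at *
  simp
  generalize ((fderiv ℝ f₀ z) 1) = a at *
  generalize ((fderiv ℝ f₀ z) Complex.I) = b at *
  generalize ((fderiv ℝ p z) 1) = c at *
  generalize ((fderiv ℝ p z) Complex.I) = d at *
  generalize ((fderiv ℝ q z) 1) = e at *
  generalize ((fderiv ℝ q z) Complex.I) = g at *
  have h3 : Φ z = (f₀ z : ℂ) * (c + Complex.I * d) := by rw [h1]; field_simp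
  rw [h3] at h2
  have h4 : (e : ℂ) = Complex.I * f₀ z * (f₀ z * (c + Complex.I * d)) - Complex.I * g := by
    rw [← h2]; ring
  rw [h4]
  field_simp
  ring_nf
  simp only [Complex.I_sq, show Complex.I ^ 3 = -Complex.I from Complex.I_pow_three]
  ring
end

section
/- Let ρ : Ω → ℝ be twice continuously differentiable and let η : Ω → ℝ be a nonvanishing continuously differentiable function satisfying ∂_z̄( η·∂_z ρ ) = 0 on Ω. Let f₀ = F ∘ ρ, where F : ℝ → ℝ is differentiable and nonvanishing, and set φ = i·η·∂_z ρ; assume φ is nonvanishing on Ω. Then: (1) ∂_z f₀ / f₀ = −(φ/conj(φ))·(∂_z̄ f₀ / f₀) on Ω; (2) if W is a continuously differentiable solution of the main Vekua equation ∂_z̄ W = (∂_z̄ f₀ / f₀)·conj(W) on Ω, then w = φ·W is a solution of the Vekua equation ∂_z̄ w = −(∂_z f₀ / f₀)·conj(w) on Ω, and conversely, if w solves the latter then W = w/φ solves the former. -/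
open Complex ComplexConjugate

theorem dzbarC_mul_aux {f g : ℂ → ℂ} {z : ℂ} (hf : DifferentiableAt ℝ f z)
    (hg : DifferentiableAt ℝ g z) :
    dzbarC (fun ζ => f ζ * g ζ) z = f z * dzbarC g z + g z * dzbarC f z := by
  have h : fderiv ℝ (fun ζ => f ζ * g ζ) z = f z • fderiv ℝ g z + g z • fderiv ℝ f z :=
    fderiv_fun_mul hf hg
  simp only [dzbarC, pdxC, pdyC, h, ContinuousLinearMap.add_apply,
    ContinuousLinearMap.smul_apply, smul_eq_mul]
  ring

/-- if `∂_z̄(η ∂_z ρ) = 0`, `f₀ = F ∘ ρ`, and `φ = i η ∂_z ρ` is nonvanishing,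
then (1) `∂_z f₀/f₀ = −(φ/conj φ)(∂_z̄ f₀/f₀)`, and (2) `W ↦ φW` maps solutions of the main
Vekua equation `∂_z̄ W = (∂_z̄ f₀/f₀) conj(W)` to solutions of
`∂_z̄ w = −(∂_z f₀/f₀) conj(w)` and `w ↦ w/φ` maps them back. -/
theorem condition_S_equivalence_of_Vekua_equations
    (Ω : Set ℂ) (hΩ : IsOpen Ω) (ρ η : ℂ → ℝ) (F : ℝ → ℝ)
    (hρC2 : ContDiffOn ℝ 2 ρ Ω)
    (hηC1 : ContDiffOn ℝ 1 η Ω)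
    (hηne : ∀ z ∈ Ω, η z ≠ 0)
    (heq : ∀ z ∈ Ω, dzbarC (fun w => (η w : ℂ) * dzR ρ w) z = 0)
    (hF : Differentiable ℝ F)
    (hFne : ∀ t, F t ≠ 0)
    (f₀ : ℂ → ℝ) (hf₀ : ∀ z, f₀ z = F (ρ z))
    (φ : ℂ → ℂ) (hφ : ∀ z, φ z = Complex.I * (η z : ℂ) * dzR ρ z)
    (hφne : ∀ z ∈ Ω, φ z ≠ 0) :
    (∀ z ∈ Ω, dzR f₀ z / (f₀ z : ℂ) = -(φ z / conj (φ z)) * (dzbarR f₀ z / (f₀ z : ℂ))) ∧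
    (∀ W : ℂ → ℂ, ContDiffOn ℝ 1 W Ω →
      (∀ z ∈ Ω, dzbarC W z = dzbarR f₀ z / (f₀ z : ℂ) * conj (W z)) →
      ∀ z ∈ Ω, dzbarC (fun ζ => φ ζ * W ζ) z
        = -(dzR f₀ z / (f₀ z : ℂ)) * conj (φ z * W z)) ∧
    (∀ w : ℂ → ℂ, ContDiffOn ℝ 1 w Ω →
      (∀ z ∈ Ω, dzbarC w z = -(dzR f₀ z / (f₀ z : ℂ)) * conj (w z)) →
      ∀ z ∈ Ω, dzbarC (fun ζ => w ζ / φ ζ) z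
        = dzbarR f₀ z / (f₀ z : ℂ) * conj (w z / φ z)) := by
  have hd : ∀ z ∈ Ω, DifferentiableAt ℝ (fun w => (η w : ℂ) * dzR ρ w) z := by
    intro z hz
    have hη : DifferentiableAt ℝ η z :=
      (hηC1.differentiableOn (by norm_num)).differentiableAt (hΩ.mem_nhds hz)
    have hfd : DifferentiableAt ℝ (fderiv ℝ ρ) z :=
      ((hρC2.contDiffAt (hΩ.mem_nhds hz)).fderiv_right (m := 1) (by norm_num)).differentiableAt
        (by norm_num)
    have hx : DifferentiableAt ℝ (fun w => (fderiv ℝ ρ w 1 : ℝ)) z :=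
      hfd.clm_apply (differentiableAt_const _)
    have hy : DifferentiableAt ℝ (fun w => (fderiv ℝ ρ w Complex.I : ℝ)) z :=
      hfd.clm_apply (differentiableAt_const _)
    have key : ∀ u : ℂ → ℝ, DifferentiableAt ℝ u z →
        DifferentiableAt ℝ (fun w => (u w : ℂ)) z := fun u hu =>
      Complex.ofRealCLM.differentiableAt.comp z hu
    exact (key η hη).mul ((key _ hx).sub ((differentiableAt_const _).mul (key _ hy)))
  have hφf : φ = fun ζ => (fun _ : ℂ => Complex.I) ζ * ((η ζ : ℂ) * dzR ρ ζ) := by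
    funext ζ
    rw [hφ ζ, mul_assoc]
  have hφd : ∀ z ∈ Ω, DifferentiableAt ℝ φ z := by
    intro z hz
    rw [hφf]
    exact (differentiableAt_const _).mul (hd z hz)
  have hφ0 : ∀ z ∈ Ω, dzbarC φ z = 0 := by
    intro z hz
    rw [hφf, dzbarC_mul_aux (differentiableAt_const _) (hd z hz), heq z hz]
    simp [dzbarC, pdxC, pdyC]
  have h1 : ∀ z ∈ Ω,
      dzR f₀ z / (f₀ z : ℂ) = -(φ z / conj (φ z)) * (dzbarR f₀ z / (f₀ z : ℂ)) := by
    intro z hz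
    have hρ : DifferentiableAt ℝ ρ z :=
      (hρC2.differentiableOn (by norm_num)).differentiableAt (hΩ.mem_nhds hz)
    have hff : f₀ = F ∘ ρ := funext hf₀
    have hfd : fderiv ℝ f₀ z = deriv F (ρ z) • fderiv ℝ ρ z := by
      rw [hff]
      exact ((hF (ρ z)).hasDerivAt.comp_hasFDerivAt z hρ.hasFDerivAt).fderiv
    have ha : dzR f₀ z = ((deriv F (ρ z) : ℝ) : ℂ) * dzR ρ z := by
      simp only [dzR, pdxR, pdyR, hfd, ContinuousLinearMap.smul_apply, smul_eq_mul]
      push_cast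
      ring
    have hb : dzbarR f₀ z = ((deriv F (ρ z) : ℝ) : ℂ) * dzbarR ρ z := by
      simp only [dzbarR, pdxR, pdyR, hfd, ContinuousLinearMap.smul_apply, smul_eq_mul]
      push_cast
      ring
    have hc : conj (φ z) = -(Complex.I * (η z : ℂ) * dzbarR ρ z) := by
      rw [hφ z]
      simp [dzR, dzbarR]
    have hcne : conj (φ z) ≠ 0 := (map_ne_zero _).2 (hφne z hz)
    have e : dzR f₀ z * conj (φ z) = -(φ z * dzbarR f₀ z) := by
      rw [ha, hb, hc, hφ z]
      ring
    have hf0 : (f₀ z : ℂ) ≠ 0 := by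
      rw [hf₀ z]
      exact_mod_cast hFne _
    field_simp
    exact e
  have h2 : ∀ z ∈ Ω, dzR f₀ z / (f₀ z : ℂ) * conj (φ z)
      = -(φ z * (dzbarR f₀ z / (f₀ z : ℂ))) := by
    intro z hz
    have hcne : conj (φ z) ≠ 0 := (map_ne_zero _).2 (hφne z hz)
    rw [h1 z hz]
    generalize dzbarR f₀ z / (f₀ z : ℂ) = a
    field_simp
  refine ⟨h1, ?_, ?_⟩
  · intro W hW hV z hz
    have hWd : DifferentiableAt ℝ W z :=
      (hW.differentiableOn (by norm_num)).differentiableAt (hΩ.mem_nhds hz)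
    rw [dzbarC_mul_aux (hφd z hz) hWd, hφ0 z hz, hV z hz, map_mul]
    linear_combination conj (W z) * h2 z hz
  · intro w hw hV z hz
    have hwd : DifferentiableAt ℝ w z :=
      (hw.differentiableOn (by norm_num)).differentiableAt (hΩ.mem_nhds hz)
    have hWd : DifferentiableAt ℝ (fun ζ => w ζ / φ ζ) z := by
      simp only [div_eq_mul_inv]
      exact hwd.mul ((hφd z hz).inv (hφne z hz))
    have hev : (fun ζ => φ ζ * (w ζ / φ ζ)) =ᶠ[nhds z] w := by
      filter_upwards [hΩ.mem_nhds hz] with ζ hζ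
      exact mul_div_cancel₀ _ (hφne ζ hζ)
    have hm := dzbarC_mul_aux (hφd z hz) hWd
    have hE : dzbarC (fun ζ => φ ζ * (w ζ / φ ζ)) z = dzbarC w z := by
      simp only [dzbarC, pdxC, pdyC, hev.fderiv_eq]
    rw [hE, hφ0 z hz, hV z hz, mul_zero, add_zero] at hm
    have hwz : conj (w z) = conj (φ z) * conj (w z / φ z) := by
      rw [← map_mul, mul_div_cancel₀ _ (hφne z hz)]
    rw [hwz] at hm
    apply mul_left_cancel₀ (hφne z hz)
    linear_combination (-1 : ℂ) * hm - conj (w z / φ z) * h2 z hz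
end

section
/- Let ρ : Ω → ℝ be twice continuously differentiable and suppose ρ satisfies Condition S: there is a continuous function s : ℝ → ℝ with Δρ = s(ρ)·|∇ρ|² on Ω. Let S : ℝ → ℝ be an antiderivative of s. Then the function η = exp(−S(ρ)) satisfies ∂_z̄( η·∂_z ρ ) = 0 on Ω. -/
open Complex ComplexConjugate

/-- if `ρ` satisfies Condition S, i.e. `Δρ = s(ρ)|∇ρ|²` for some continuous
`s : ℝ → ℝ`, and `S` is an antiderivative of `s`, then `η = exp(−S(ρ))` satisfies
`∂_z̄(η ∂_z ρ) = 0`. -/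
theorem condition_S_gives_eta
    (Ω : Set ℂ) (hΩ : IsOpen Ω) (ρ : ℂ → ℝ) (s S : ℝ → ℝ)
    (hρC2 : ContDiffOn ℝ 2 ρ Ω)
    (hs : Continuous s)
    (hcondS : ∀ z ∈ Ω, lapR ρ z = s (ρ z) * gradNormSq ρ z)
    (hS : ∀ t, HasDerivAt S (s t) t)
    (η : ℂ → ℝ) (hη : ∀ z, η z = Real.exp (-S (ρ z))) :
    ∀ z ∈ Ω, dzbarC (fun w => (η w : ℂ) * dzR ρ w) z = 0 := by
  intro z hz
  have hc : ContDiffAt ℝ 2 ρ z := hρC2.contDiffAt (hΩ.mem_nhds hz)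
  have h1 : HasFDerivAt ρ (fderiv ℝ ρ z) z := (hc.differentiableAt (by norm_num)).hasFDerivAt
  have h2 : HasFDerivAt (fderiv ℝ ρ) (fderiv ℝ (fderiv ℝ ρ) z) z :=
    ((hc.fderiv_right (m := 1) (by norm_num)).differentiableAt (by norm_num)).hasFDerivAt
  have hsymm : fderiv ℝ (fderiv ℝ ρ) z 1 Complex.I = fderiv ℝ (fderiv ℝ ρ) z Complex.I 1 :=
    (hc.isSymmSndFDerivAt (by simp)) 1 Complex.I
  have hx : HasFDerivAt (pdxR ρ)
      ((ContinuousLinearMap.apply ℝ ℝ (1 : ℂ)).comp (fderiv ℝ (fderiv ℝ ρ) z)) z :=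
    (ContinuousLinearMap.apply ℝ ℝ (1 : ℂ)).hasFDerivAt.comp z h2
  have hy : HasFDerivAt (pdyR ρ)
      ((ContinuousLinearMap.apply ℝ ℝ Complex.I).comp (fderiv ℝ (fderiv ℝ ρ) z)) z :=
    (ContinuousLinearMap.apply ℝ ℝ Complex.I).hasFDerivAt.comp z h2
  have he : HasFDerivAt η ((Real.exp (-S (ρ z)) * -s (ρ z)) • fderiv ℝ ρ z) z := by
    have : η = (fun t => Real.exp (-S t)) ∘ ρ := funext hη
    rw [this]
    exact ((hS (ρ z)).neg.exp).comp_hasFDerivAt z h1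
  have hxC := Complex.ofRealCLM.hasFDerivAt.comp z hx
  have hyC := Complex.ofRealCLM.hasFDerivAt.comp z hy
  have heC := Complex.ofRealCLM.hasFDerivAt.comp z he
  have hf : HasFDerivAt (fun w => (η w : ℂ) * dzR ρ w) _ z :=
    heC.mul (hxC.sub (hyC.const_mul Complex.I))
  have hS' := hcondS z hz
  have hlap : lapR ρ z = fderiv ℝ (fderiv ℝ ρ) z 1 1
      + fderiv ℝ (fderiv ℝ ρ) z Complex.I Complex.I := by
    unfold lapR
    rw [pdxR, pdyR, hx.fderiv, hy.fderiv]
    simp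
  rw [hlap, gradNormSq] at hS'
  have hSC := congrArg (fun t : ℝ => (t : ℂ)) hS'
  unfold dzbarC pdxC pdyC
  rw [hf.fderiv]
  simp [hsymm, hη, dzR, pdxR, pdyR] at hSC ⊢
  have hI := Complex.I_sq
  generalize Complex.exp (-(S (ρ z) : ℂ)) = e
  generalize (((fderiv ℝ (fderiv ℝ ρ) z) 1 1 : ℝ) : ℂ) = a at *
  generalize (((fderiv ℝ (fderiv ℝ ρ) z) Complex.I Complex.I : ℝ) : ℂ) = b at *
  generalize (((fderiv ℝ (fderiv ℝ ρ) z) Complex.I 1 : ℝ) : ℂ) = c at *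
  generalize (((fderiv ℝ ρ z) 1 : ℝ) : ℂ) = p at *
  generalize (((fderiv ℝ ρ z) Complex.I : ℝ) : ℂ) = q at *
  generalize ((s (ρ z) : ℝ) : ℂ) = σ at *
  generalize Complex.I = i at *
  linear_combination e * hSC + (-e * b + e * σ * q ^ 2) * hI
end

section
/- Let ρ : Ω → ℝ be twice continuously differentiable with ∇ρ nonvanishing on Ω, and let η : Ω → ℝ be nonvanishing, continuously differentiable, and satisfy ∂_z̄( η·∂_z ρ ) = 0 on Ω. Then ∂_z̄( log|η| ) = −( Δρ / |∇ρ|² )·∂_z̄ ρ on Ω; equivalently, ∇(log|η|) = −( Δρ / |∇ρ|² )·∇ρ, so that the gradient of log|η| is everywhere parallel to ∇ρ with proportionality factor −Δρ/|∇ρ|². -/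
open Complex ComplexConjugate

/-- if `∇ρ` is nonvanishing and a nonvanishing `η` satisfies
`∂_z̄(η ∂_z ρ) = 0`, then `∂_z̄(log|η|) = −(Δρ/|∇ρ|²) ∂_z̄ ρ`, i.e. the gradient of
`log|η|` is proportional to `∇ρ` with factor `−Δρ/|∇ρ|²`. -/
theorem eta_forces_condition_S_shape
    (Ω : Set ℂ) (hΩ : IsOpen Ω) (ρ η : ℂ → ℝ)
    (hρC2 : ContDiffOn ℝ 2 ρ Ω)
    (hgradne : ∀ z ∈ Ω, gradNormSq ρ z ≠ 0)
    (hηC1 : ContDiffOn ℝ 1 η Ω)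
    (hηne : ∀ z ∈ Ω, η z ≠ 0)
    (heq : ∀ z ∈ Ω, dzbarC (fun w => (η w : ℂ) * dzR ρ w) z = 0) :
    ∀ z ∈ Ω,
      dzbarR (fun w => Real.log |η w|) z
        = -((lapR ρ z / gradNormSq ρ z : ℝ) : ℂ) * dzbarR ρ z := by
  intro z hz
  have hΩz : Ω ∈ nhds z := hΩ.mem_nhds hz
  have hρz : ContDiffAt ℝ 2 ρ z := hρC2.contDiffAt hΩz
  have hηz : DifferentiableAt ℝ η z := (hηC1.contDiffAt hΩz).differentiableAt (by norm_num)
  have hD : DifferentiableAt ℝ (fderiv ℝ ρ) z :=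
    (hρz.fderiv_right (m := 1) (by norm_num)).differentiableAt (by norm_num)
  have hsymm : fderiv ℝ (fderiv ℝ ρ) z 1 Complex.I = fderiv ℝ (fderiv ℝ ρ) z Complex.I 1 :=
    (hρz.isSymmSndFDerivAt (by simp)) 1 Complex.I
  have hA : ∀ v : ℂ, HasFDerivAt (fun w => fderiv ℝ ρ w v)
      ((ContinuousLinearMap.apply ℝ ℝ v).comp (fderiv ℝ (fderiv ℝ ρ) z)) z := fun v =>
    (ContinuousLinearMap.apply ℝ ℝ v).hasFDerivAt.comp z hD.hasFDerivAt
  have hax : HasFDerivAt (pdxR ρ) _ z := hA 1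
  have hay : HasFDerivAt (pdyR ρ) _ z := hA Complex.I
  have hc : ∀ {f : ℂ → ℝ} {f' : ℂ →L[ℝ] ℝ}, HasFDerivAt f f' z →
      HasFDerivAt (fun w => (f w : ℂ)) (Complex.ofRealCLM.comp f') z := fun h =>
    Complex.ofRealCLM.hasFDerivAt.comp z h
  have hF := (hc hηz.hasFDerivAt).mul ((hc hax).sub ((hc hay).const_mul Complex.I))
  have hF' : HasFDerivAt (fun w => (η w : ℂ) * dzR ρ w) _ z := hF
  have h0 := heq z hz
  have hlog : HasFDerivAt (fun w => Real.log |η w|) ((η z)⁻¹ • fderiv ℝ η z) z := by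
    simp only [Real.log_abs]
    exact hηz.hasFDerivAt.log (hηne z hz)
  have hG := hgradne z hz
  have he := hηne z hz
  simp only [dzbarC, pdxC, pdyC, hF'.fderiv] at h0
  have hL : lapR ρ z = fderiv ℝ (fderiv ℝ ρ) z 1 1
      + fderiv ℝ (fderiv ℝ ρ) z Complex.I Complex.I := by
    simp only [lapR]
    rw [pdxR, pdyR, hax.fderiv, hay.fderiv]
    simp
  have h1 := congrArg Complex.re h0
  have h2 := congrArg Complex.im h0
  simp [hsymm] at h1 h2
  rw [hL]
  simp only [dzbarR]
  rw [pdxR, pdyR, hlog.fderiv]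
  simp only [gradNormSq] at hG ⊢
  change _ = _ * ((pdxR ρ z : ℂ) + Complex.I * (pdyR ρ z : ℂ))
  simp only [ContinuousLinearMap.smul_apply, smul_eq_mul]
  generalize fderiv ℝ η z 1 = p at *
  generalize fderiv ℝ η z Complex.I = q at *
  generalize pdxR ρ z = a at *
  generalize pdyR ρ z = b at *
  generalize η z = e at *
  generalize fderiv ℝ (fderiv ℝ ρ) z 1 1 = r at *
  generalize fderiv ℝ (fderiv ℝ ρ) z Complex.I Complex.I = t at *
  generalize fderiv ℝ (fderiv ℝ ρ) z Complex.I 1 = u at *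
  have k1 : e⁻¹ * p = -((r + t) / (a ^ 2 + b ^ 2)) * a := by
    field_simp
    linear_combination a * h1 - b * h2
  have k2 : e⁻¹ * q = -((r + t) / (a ^ 2 + b ^ 2)) * b := by
    field_simp
    linear_combination b * h1 + a * h2
  rw [k1, k2]
  push_cast
  ring
end

section
/- Let f₀ : Ω → ℝ be nonvanishing and continuously differentiable and let φ : Ω → ℂ be a nonvanishing analytic function satisfying ∂_z f₀ / f₀ = −(φ/conj(φ))·(∂_z̄ f₀ / f₀) on Ω. For each integer m define F_m = φ^m · f₀ and G_m = φ^m · i / f₀. Then for every m ∈ ℤ: (1) Im( conj(F_m)·G_m ) > 0 on Ω, so (F_m, G_m) is a generating pair; (2) a_{(F_m,G_m)} = 0 on Ω; (3) b_{(F_m,G_m)} = −B_{(F_{m−1},G_{m−1})} on Ω. Consequently {(F_m, G_m)}_{m∈ℤ} is a generating sequence in which the pair (f₀, i/f₀) is embedded. -/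
open Complex ComplexConjugate

/-- Characteristic coefficient `a_{(F,G)}` of a generating pair. -/
noncomputable def charSmallA (F G : ℂ → ℂ) (z : ℂ) : ℂ :=
  -(conj (F z) * dzbarC G z - dzbarC F z * conj (G z)) /
    (F z * conj (G z) - conj (F z) * G z)

/-- Characteristic coefficient `b_{(F,G)}` of a generating pair. -/
noncomputable def charSmallB (F G : ℂ → ℂ) (z : ℂ) : ℂ :=
  (F z * dzbarC G z - dzbarC F z * G z) / (F z * conj (G z) - conj (F z) * G z)

/-- Characteristic coefficient `A_{(F,G)}` of a generating pair. -/
noncomputable def charBigA (F G : ℂ → ℂ) (z : ℂ) : ℂ :=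
  -(conj (F z) * dzC G z - dzC F z * conj (G z)) /
    (F z * conj (G z) - conj (F z) * G z)

/-- Characteristic coefficient `B_{(F,G)}` of a generating pair. -/
noncomputable def charBigB (F G : ℂ → ℂ) (z : ℂ) : ℂ :=
  (F z * dzC G z - dzC F z * G z) / (F z * conj (G z) - conj (F z) * G z)

theorem hasderiv_aux (Ω : Set ℂ) (hΩ : IsOpen Ω) (f₀ : ℂ → ℝ) (φ : ℂ → ℂ)
    (hf₀C1 : ContDiffOn ℝ 1 f₀ Ω)
    (hf₀ne : ∀ z ∈ Ω, f₀ z ≠ 0)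
    (hφhol : DifferentiableOn ℂ φ Ω)
    (hφne : ∀ z ∈ Ω, φ z ≠ 0) (m : ℤ) (z : ℂ) (hz : z ∈ Ω) :
    ∃ d : ℂ, (∀ v, fderiv ℝ (fun w => φ w ^ m * (f₀ w : ℂ)) z v
        = d * v * f₀ z + φ z ^ m * (fderiv ℝ f₀ z v : ℝ)) ∧
      (∀ v, fderiv ℝ (fun w => φ w ^ m * Complex.I / (f₀ w : ℂ)) z v
        = d * v * Complex.I / f₀ z
          - φ z ^ m * Complex.I * (fderiv ℝ f₀ z v : ℝ) / (f₀ z : ℂ) ^ 2) := by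
  have hφd : DifferentiableAt ℂ φ z := hφhol.differentiableAt (hΩ.mem_nhds hz)
  have hP : DifferentiableAt ℂ (fun w => φ w ^ m) z :=
    hφd.zpow (Or.inl (hφne z hz))
  have hfd : DifferentiableAt ℝ f₀ z :=
    (hf₀C1.contDiffAt (hΩ.mem_nhds hz)).differentiableAt (by norm_num)
  have hne : (f₀ z : ℂ) ≠ 0 := by exact_mod_cast hf₀ne z hz
  have h1 := hP.hasDerivAt.hasFDerivAt.restrictScalars ℝ
  have h2 : HasFDerivAt (fun w => (f₀ w : ℂ)) (Complex.ofRealCLM.comp (fderiv ℝ f₀ z)) z :=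
    Complex.ofRealCLM.hasFDerivAt.comp z hfd.hasFDerivAt
  refine ⟨deriv (fun w => φ w ^ m) z, fun v => ?_, fun v => ?_⟩
  · have e : (fun w => φ w ^ m * (f₀ w : ℂ))
      = (fun w => φ w ^ m) * (fun w => (f₀ w : ℂ)) := rfl
    rw [e, (h1.mul h2).fderiv]
    simp
    ring
  · have h3 : HasFDerivAt (fun w => ((f₀ w : ℂ))⁻¹) _ z :=
      ((hasDerivAt_inv hne).hasFDerivAt.restrictScalars ℝ).comp z h2
    have h4 := (h1.mul_const Complex.I).mul h3
    have e : (fun w => φ w ^ m * Complex.I / (f₀ w : ℂ))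
      = (fun w => φ w ^ m * Complex.I) * (fun w => ((f₀ w : ℂ))⁻¹) := by
      funext w; simp [div_eq_mul_inv]
    rw [e, h4.fderiv]
    simp
    field_simp
    ring

/-- with `φ` nonvanishing analytic and
`∂_z f₀/f₀ = −(φ/conj φ)(∂_z̄ f₀/f₀)`, the pairs `F_m = φ^m f₀`, `G_m = φ^m i/f₀` (`m ∈ ℤ`)
form a generating sequence in which `(f₀, i/f₀)` is embedded: each `(F_m, G_m)` is a
generating pair, `a_{(F_m,G_m)} = 0` and `b_{(F_m,G_m)} = −B_{(F_{m−1},G_{m−1})}`. -/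
theorem explicit_generating_sequence
    (Ω : Set ℂ) (hΩ : IsOpen Ω) (f₀ : ℂ → ℝ) (φ : ℂ → ℂ)
    (hf₀C1 : ContDiffOn ℝ 1 f₀ Ω)
    (hf₀ne : ∀ z ∈ Ω, f₀ z ≠ 0)
    (hφhol : DifferentiableOn ℂ φ Ω)
    (hφne : ∀ z ∈ Ω, φ z ≠ 0)
    (hrel : ∀ z ∈ Ω, dzR f₀ z / (f₀ z : ℂ)
      = -(φ z / conj (φ z)) * (dzbarR f₀ z / (f₀ z : ℂ)))
    (Fm Gm : ℤ → ℂ → ℂ)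
    (hFm : ∀ (m : ℤ) (z : ℂ), Fm m z = φ z ^ m * (f₀ z : ℂ))
    (hGm : ∀ (m : ℤ) (z : ℂ), Gm m z = φ z ^ m * Complex.I / (f₀ z : ℂ)) :
    (∀ z, Fm 0 z = (f₀ z : ℂ) ∧ Gm 0 z = Complex.I / (f₀ z : ℂ)) ∧
    (∀ (m : ℤ), ∀ z ∈ Ω,
      0 < (conj (Fm m z) * Gm m z).im ∧
      charSmallA (Fm m) (Gm m) z = 0 ∧
      charSmallB (Fm m) (Gm m) z = -charBigB (Fm (m - 1)) (Gm (m - 1)) z) := by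
  have hF : ∀ m, Fm m = fun w => φ w ^ m * (f₀ w : ℂ) := fun m => funext (hFm m)
  have hG : ∀ m, Gm m = fun w => φ w ^ m * Complex.I / (f₀ w : ℂ) := fun m => funext (hGm m)
  refine ⟨fun z => by simp [hFm, hGm], fun m z hz => ?_⟩
  have hne : (f₀ z : ℂ) ≠ 0 := by exact_mod_cast hf₀ne z hz
  have hp : φ z ≠ 0 := hφne z hz
  have hpc : conj (φ z) ≠ 0 := by simpa using hp
  have hI2 : Complex.I ^ 2 = -1 := Complex.I_sq
  have hr := hrel z hz
  have hIne := Complex.I_ne_zero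
  obtain ⟨d, h1, h2⟩ := hasderiv_aux Ω hΩ f₀ φ hf₀C1 hf₀ne hφhol hφne m z hz
  obtain ⟨d', h1', h2'⟩ := hasderiv_aux Ω hΩ f₀ φ hf₀C1 hf₀ne hφhol hφne (m - 1) z hz
  have hden : ∀ k : ℤ, Fm k z * conj (Gm k z) - conj (Fm k z) * Gm k z
      = -2 * Complex.I * (φ z ^ k * conj (φ z) ^ k) := by
    intro k
    simp only [hFm, hGm, map_mul, map_div₀, map_zpow₀, Complex.conj_I, Complex.conj_ofReal]
    field_simp
    ring
  have zF : dzbarC (Fm m) z = φ z ^ m * dzbarR f₀ z := by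
    simp only [dzbarC, pdxC, pdyC, dzbarR, pdxR, pdyR, hF, h1]
    linear_combination d * f₀ z * hI2
  have zG : dzbarC (Gm m) z = -(φ z ^ m * Complex.I * dzbarR f₀ z / (f₀ z : ℂ) ^ 2) := by
    simp only [dzbarC, pdxC, pdyC, dzbarR, pdxR, pdyR, hG, h2]
    linear_combination d * Complex.I / f₀ z * hI2
  have wF : dzC (Fm (m - 1)) z = 2 * d' * f₀ z + φ z ^ (m - 1) * dzR f₀ z := by
    simp only [dzC, pdxC, pdyC, dzR, pdxR, pdyR, hF, h1']
    linear_combination -d' * f₀ z * hI2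
  have wG : dzC (Gm (m - 1)) z = 2 * d' * Complex.I / f₀ z
      - φ z ^ (m - 1) * Complex.I * dzR f₀ z / (f₀ z : ℂ) ^ 2 := by
    simp only [dzC, pdxC, pdyC, dzR, pdxR, pdyR, hG, h2']
    linear_combination -d' * Complex.I / f₀ z * hI2
  refine ⟨?_, ?_, ?_⟩
  · have e : conj (Fm m z) * Gm m z = ((Complex.normSq (φ z ^ m) : ℝ) : ℂ) * Complex.I := by
      rw [Complex.normSq_eq_conj_mul_self]
      simp only [hFm, hGm, map_mul, Complex.conj_ofReal]
      field_simp
    rw [e, Complex.im_ofReal_mul, Complex.I_im, mul_one]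
    exact Complex.normSq_pos.2 (zpow_ne_zero _ hp)
  · rw [charSmallA, zF, zG]
    have : conj (Fm m z) * -(φ z ^ m * Complex.I * dzbarR f₀ z / (f₀ z : ℂ) ^ 2)
        - φ z ^ m * dzbarR f₀ z * conj (Gm m z) = 0 := by
      simp only [hFm, hGm, map_mul, map_div₀, map_zpow₀, Complex.conj_I, Complex.conj_ofReal]
      field_simp
      ring
    rw [this]; simp
  · have hb : charSmallB (Fm m) (Gm m) z
        = φ z ^ m / conj (φ z) ^ m * (dzbarR f₀ z / f₀ z) := by
      rw [charSmallB, zF, zG, hden, hFm, hGm]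
      field_simp
      ring
    have hB : charBigB (Fm (m - 1)) (Gm (m - 1)) z
        = φ z ^ (m - 1) / conj (φ z) ^ (m - 1) * (dzR f₀ z / f₀ z) := by
      rw [charBigB, wF, wG, hden, hFm, hGm]
      generalize hX : φ z ^ (m - 1) = X
      generalize hY : conj (φ z) ^ (m - 1) = Y
      have : X ≠ 0 := hX ▸ zpow_ne_zero _ hp
      have : Y ≠ 0 := hY ▸ zpow_ne_zero _ hpc
      field_simp
      ring
    rw [hb, hB, hr, zpow_sub_one₀ hp, zpow_sub_one₀ hpc]
    field_simp
end

section
/- Let f₀ : Ω → ℝ be nonvanishing and continuously differentiable, and let φ, ψ : Ω → ℝ be continuously differentiable. Then the function W = φ·f₀ + i·ψ/f₀ is a solution of the main Vekua equation ∂_z̄ W = (∂_z̄ f₀ / f₀)·conj(W) on Ω if and only if ∂_z̄ ψ − i·f₀²·∂_z̄ φ = 0 on Ω, which in turn holds if and only if the pair (φ, ψ) satisfies the p-analytic system with p = f₀²: ∂_x ψ + f₀²·∂_y φ = 0 and ∂_y ψ − f₀²·∂_x φ = 0 on Ω. -/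
open Complex ComplexConjugate

/-- `W = φ f₀ + iψ/f₀` solves the main Vekua equation iff
`∂_z̄ ψ − i f₀² ∂_z̄ φ = 0`, iff `(φ, ψ)` satisfies the `p`-analytic system with `p = f₀²`:
`∂_x ψ + f₀² ∂_y φ = 0` and `∂_y ψ − f₀² ∂_x φ = 0`. -/
theorem main_Vekua_iff_p_analytic
    (Ω : Set ℂ) (hΩ : IsOpen Ω) (f₀ φ ψ : ℂ → ℝ)
    (hf₀C1 : ContDiffOn ℝ 1 f₀ Ω)
    (hf₀ne : ∀ z ∈ Ω, f₀ z ≠ 0)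
    (hφC1 : ContDiffOn ℝ 1 φ Ω) (hψC1 : ContDiffOn ℝ 1 ψ Ω)
    (W : ℂ → ℂ)
    (hW : ∀ z, W z = (φ z : ℂ) * (f₀ z : ℂ) + Complex.I * (ψ z : ℂ) / (f₀ z : ℂ)) :
    ∀ z ∈ Ω,
      ((dzbarC W z = dzbarR f₀ z / (f₀ z : ℂ) * conj (W z))
        ↔ dzbarR ψ z - Complex.I * (f₀ z : ℂ) ^ 2 * dzbarR φ z = 0) ∧
      ((dzbarR ψ z - Complex.I * (f₀ z : ℂ) ^ 2 * dzbarR φ z = 0)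
        ↔ (pdxR ψ z + f₀ z ^ 2 * pdyR φ z = 0 ∧ pdyR ψ z - f₀ z ^ 2 * pdxR φ z = 0)) := by
  intro z hz
  have hn : Ω ∈ nhds z := hΩ.mem_nhds hz
  have hf := ((hf₀C1.contDiffAt hn).differentiableAt one_ne_zero).hasFDerivAt
  have hp := ((hφC1.contDiffAt hn).differentiableAt one_ne_zero).hasFDerivAt
  have hs := ((hψC1.contDiffAt hn).differentiableAt one_ne_zero).hasFDerivAt
  have h0 := hf₀ne z hz
  have h0c : (f₀ z : ℂ) ≠ 0 := by exact_mod_cast h0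
  have key : ∀ v : ℂ, fderiv ℝ W z v =
      (φ z : ℂ) * (fderiv ℝ f₀ z v : ℝ) + (f₀ z : ℂ) * (fderiv ℝ φ z v : ℝ)
      + Complex.I * ((fderiv ℝ ψ z v : ℝ) / (f₀ z : ℂ)
        - (ψ z : ℂ) * (fderiv ℝ f₀ z v : ℝ) / (f₀ z : ℂ) ^ 2) := by
    intro v
    have hWe : W = fun z => ((φ z * f₀ z : ℝ) : ℂ) + Complex.I * ((ψ z * (f₀ z)⁻¹ : ℝ) : ℂ) := by
      funext w
      rw [hW w]
      push_cast
      ring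
    have h1 := Complex.ofRealCLM.hasFDerivAt.comp z (hp.mul hf)
    have hinv := (hasDerivAt_inv h0).comp_hasFDerivAt z hf
    have h2 := Complex.ofRealCLM.hasFDerivAt.comp z (hs.mul hinv)
    have h3 := h1.add (h2.const_mul Complex.I)
    rw [hWe]
    refine (congrArg (fun L : ℂ →L[ℝ] ℂ => L v) (HasFDerivAt.fderiv h3)).trans ?_
    simp
    field_simp
    ring
  constructor
  · have hc : conj (W z) = (φ z : ℂ) * (f₀ z : ℂ) - Complex.I * (ψ z : ℂ) / (f₀ z : ℂ) := by
      rw [hW z]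
      simp
      ring
    have hd : dzbarC W z - dzbarR f₀ z / (f₀ z : ℂ) * conj (W z) =
        Complex.I / (f₀ z : ℂ) * (dzbarR ψ z - Complex.I * (f₀ z : ℂ) ^ 2 * dzbarR φ z) := by
      rw [hc]
      simp only [dzbarC, dzbarR, pdxC, pdyC, pdxR, pdyR, key]
      field_simp
      ring_nf
      simp only [Complex.I_sq, Complex.I_pow_three]
      ring
    rw [← sub_eq_zero, hd, mul_eq_zero]
    have : Complex.I / (f₀ z : ℂ) ≠ 0 := div_ne_zero Complex.I_ne_zero h0c
    tauto
  · have he : dzbarR ψ z - Complex.I * (f₀ z : ℂ) ^ 2 * dzbarR φ z =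
        ((pdxR ψ z + f₀ z ^ 2 * pdyR φ z : ℝ) : ℂ)
          + ((pdyR ψ z - f₀ z ^ 2 * pdxR φ z : ℝ) : ℂ) * Complex.I := by
      simp only [dzbarR]
      push_cast
      linear_combination (-(f₀ z : ℂ) ^ 2 * (pdyR φ z : ℂ)) * Complex.I_sq
    rw [he, Complex.ext_iff]
    simp only [Complex.add_re, Complex.add_im, Complex.re_ofReal_mul, Complex.im_ofReal_mul,
      Complex.ofReal_re, Complex.ofReal_im, Complex.I_re, Complex.I_im, Complex.zero_re,
      Complex.zero_im, mul_zero, mul_one, add_zero, zero_add]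
end

section
/- Let a > 0, and for z = x + iy set r₁ = √((x + a/2)² + y²), r₂ = √((x − a/2)² + y²), and ρ = r₁ + r₂ (so ρ = a·cosh μ in elliptic coordinates). Then on Ω = ℂ minus the closed segment joining the foci −a/2 and a/2, the identities |∇ρ|² = (ρ² − a²)/(r₁·r₂) and Δρ = ρ/(r₁·r₂) hold, and consequently Δρ / |∇ρ|² = ρ/(ρ² − a²); in particular the elliptic coordinate ρ satisfies Condition S with s(ρ) = ρ/(ρ² − a²). -/
open Complex ComplexConjugate

noncomputable def Daux (c : ℝ) (z : ℂ) : ℝ := Real.sqrt ((z.re + c) ^ 2 + z.im ^ 2)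

lemma Daux_sq (c : ℝ) (z : ℂ) : Daux c z ^ 2 = (z.re + c) ^ 2 + z.im ^ 2 :=
  Real.sq_sqrt (by positivity)

lemma Daux_cont (c : ℝ) : Continuous (Daux c) := by
  unfold Daux
  have h1 := Complex.continuous_re
  have h2 := Complex.continuous_im
  fun_prop

lemma hasF_re (c : ℝ) (z : ℂ) : HasFDerivAt (fun w : ℂ => w.re + c) Complex.reCLM z :=
  (Complex.reCLM.hasFDerivAt (x := z)).add_const c

lemma hasF_im (z : ℂ) : HasFDerivAt (fun w : ℂ => w.im) Complex.imCLM z :=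
  Complex.imCLM.hasFDerivAt (x := z)

lemma Daux_hasF (c : ℝ) (z : ℂ) (h : Daux c z ≠ 0) :
    HasFDerivAt (Daux c)
      (((z.re + c) / Daux c z) • Complex.reCLM + (z.im / Daux c z) • Complex.imCLM) z := by
  have h0 : (z.re + c) ^ 2 + z.im ^ 2 ≠ 0 := by
    rw [← Daux_sq]; exact pow_ne_zero 2 h
  have := (((hasF_re c z).pow 2).add ((hasF_im z).pow 2)).sqrt h0
  refine this.congr_fderiv ?_
  change (1 / (2 * Daux c z)) • _ = _
  ext v <;> simp <;> field_simp

lemma Daux_x (c : ℝ) (z : ℂ) (h : Daux c z ≠ 0) :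
    DifferentiableAt ℝ (fun w => (w.re + c) / Daux c w) z ∧
    fderiv ℝ (fun w => (w.re + c) / Daux c w) z 1 = z.im ^ 2 / Daux c z ^ 3 := by
  have := (hasF_re c z).fun_mul ((hasDerivAt_inv h).comp_hasFDerivAt z (Daux_hasF c z h))
  simp only [Function.comp_apply, ← div_eq_mul_inv] at this
  refine ⟨this.differentiableAt, ?_⟩
  rw [this.fderiv]
  have hs := Daux_sq c z
  simp
  field_simp
  linear_combination hs

lemma Daux_y (c : ℝ) (z : ℂ) (h : Daux c z ≠ 0) :
    DifferentiableAt ℝ (fun w => w.im / Daux c w) z ∧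
    fderiv ℝ (fun w => w.im / Daux c w) z Complex.I = (z.re + c) ^ 2 / Daux c z ^ 3 := by
  have := (hasF_im z).fun_mul ((hasDerivAt_inv h).comp_hasFDerivAt z (Daux_hasF c z h))
  simp only [Function.comp_apply, ← div_eq_mul_inv] at this
  refine ⟨this.differentiableAt, ?_⟩
  rw [this.fderiv]
  have hs := Daux_sq c z
  simp
  field_simp
  linear_combination hs

lemma Daux_zero (c : ℝ) (z : ℂ) (h : Daux c z = 0) : z = Complex.ofReal (-c) := by
  have hs := Daux_sq c z
  rw [h] at hs
  have h1 : z.re + c = 0 := by nlinarith [sq_nonneg (z.re + c), sq_nonneg z.im]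
  have h2 : z.im = 0 := by nlinarith [sq_nonneg (z.re + c), sq_nonneg z.im]
  apply Complex.ext
  · simp; linarith
  · simpa using h2

/-- the elliptic coordinate `ρ = r₁ + r₂` (with foci `±a/2`) satisfies, off the
focal segment, `|∇ρ|² = (ρ² − a²)/(r₁ r₂)`, `Δρ = ρ/(r₁ r₂)`, hence
`Δρ/|∇ρ|² = ρ/(ρ² − a²)`: Condition S holds with `s(ρ) = ρ/(ρ² − a²)`. -/
theorem elliptic_coordinate_condition_S
    (a : ℝ) (ha : 0 < a)
    (r₁ r₂ ρ : ℂ → ℝ)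
    (hr₁ : ∀ z, r₁ z = Real.sqrt ((z.re + a / 2) ^ 2 + z.im ^ 2))
    (hr₂ : ∀ z, r₂ z = Real.sqrt ((z.re - a / 2) ^ 2 + z.im ^ 2))
    (hρ : ∀ z, ρ z = r₁ z + r₂ z) :
    ∀ z : ℂ, z ∉ segment ℝ (Complex.ofReal (-(a / 2))) (Complex.ofReal (a / 2)) →
      gradNormSq ρ z = (ρ z ^ 2 - a ^ 2) / (r₁ z * r₂ z) ∧
      lapR ρ z = ρ z / (r₁ z * r₂ z) ∧
      lapR ρ z / gradNormSq ρ z = ρ z / (ρ z ^ 2 - a ^ 2) := by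
  intro z hz
  have e1 : r₁ = Daux (a / 2) := funext hr₁
  have e2 : r₂ = Daux (-(a / 2)) := by
    funext w; rw [hr₂, Daux, sub_eq_add_neg]
  have e3 : ρ = fun w => Daux (a / 2) w + Daux (-(a / 2)) w := by
    funext w; rw [hρ, e1, e2]
  have n1 : Daux (a / 2) z ≠ 0 := fun h => hz (by
    rw [Daux_zero _ _ h]; exact left_mem_segment _ _ _)
  have n2 : Daux (-(a / 2)) z ≠ 0 := fun h => hz (by
    rw [Daux_zero _ _ h, neg_neg]; exact right_mem_segment _ _ _)
  clear hr₁ hr₂ hρ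
  have F : ∀ w, Daux (a / 2) w ≠ 0 → Daux (-(a / 2)) w ≠ 0 →
      pdxR ρ w = (w.re + a / 2) / Daux (a / 2) w + (w.re + -(a / 2)) / Daux (-(a / 2)) w ∧
      pdyR ρ w = w.im / Daux (a / 2) w + w.im / Daux (-(a / 2)) w := by
    intro w m1 m2
    have := (Daux_hasF _ w m1).fun_add (Daux_hasF _ w m2)
    rw [← e3] at this
    simp [pdxR, pdyR, this.fderiv]
  have ev : ∀ᶠ w in nhds z, Daux (a / 2) w ≠ 0 ∧ Daux (-(a / 2)) w ≠ 0 :=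
    ((Daux_cont _).continuousAt.eventually_ne n1).and ((Daux_cont _).continuousAt.eventually_ne n2)
  have s1 := Daux_sq (a / 2) z
  have s2 := Daux_sq (-(a / 2)) z
  have G : gradNormSq ρ z = (ρ z ^ 2 - a ^ 2) / (r₁ z * r₂ z) := by
    rw [gradNormSq, (F z n1 n2).1, (F z n1 n2).2, e1, e2, e3]
    dsimp only
    generalize Daux (a / 2) z = p at *
    generalize Daux (-(a / 2)) z = q at *
    have k : ∀ u v y : ℝ, (u / p + v / q) ^ 2 + (y / p + y / q) ^ 2
        = (u ^ 2 + y ^ 2) / p ^ 2 + (v ^ 2 + y ^ 2) / q ^ 2 + 2 * (u * v + y ^ 2) / (p * q) := by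
      intro u v y
      field_simp
      ring
    rw [k, ← s1, ← s2, div_self (pow_ne_zero 2 n1), div_self (pow_ne_zero 2 n2)]
    field_simp
    linear_combination -2 * s1 - 2 * s2
  have L : lapR ρ z = ρ z / (r₁ z * r₂ z) := by
    have X : pdxR ρ =ᶠ[nhds z] fun w =>
        (w.re + a / 2) / Daux (a / 2) w + (w.re + -(a / 2)) / Daux (-(a / 2)) w :=
      ev.mono fun w hw => (F w hw.1 hw.2).1
    have Y : pdyR ρ =ᶠ[nhds z] fun w => w.im / Daux (a / 2) w + w.im / Daux (-(a / 2)) w :=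
      ev.mono fun w hw => (F w hw.1 hw.2).2
    obtain ⟨x1, x1'⟩ := Daux_x _ z n1
    obtain ⟨x2, x2'⟩ := Daux_x _ z n2
    obtain ⟨y1, y1'⟩ := Daux_y _ z n1
    obtain ⟨y2, y2'⟩ := Daux_y _ z n2
    have hx : pdxR (pdxR ρ) z = z.im ^ 2 / Daux (a / 2) z ^ 3 + z.im ^ 2 / Daux (-(a / 2)) z ^ 3 := by
      rw [pdxR, X.fderiv_eq, fderiv_fun_add x1 x2, add_apply, x1', x2']
    have hy : pdyR (pdyR ρ) z = (z.re + a / 2) ^ 2 / Daux (a / 2) z ^ 3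
        + (z.re + -(a / 2)) ^ 2 / Daux (-(a / 2)) z ^ 3 := by
      rw [pdyR, Y.fderiv_eq, fderiv_fun_add y1 y2, add_apply, y1', y2']
    rw [lapR, hx, hy, e1, e2, e3]
    have t1 : (z.re + a / 2) ^ 2 = Daux (a / 2) z ^ 2 - z.im ^ 2 := by rw [s1]; ring
    have t2 : (z.re + -(a / 2)) ^ 2 = Daux (-(a / 2)) z ^ 2 - z.im ^ 2 := by rw [s2]; ring
    rw [t1, t2]
    field_simp
    ring
  refine ⟨G, L, ?_⟩
  have hq : r₁ z * r₂ z ≠ 0 := by rw [e1, e2]; exact mul_ne_zero n1 n2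
  rw [G, L, div_div_div_cancel_right₀ hq]
end
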